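/- arXiv:2210.08341 — 3 statements merged into one kernel-verified Lean document; each statement's English description precedes it below -/
import Mathlib

section
/- Let d ∈ {1,2,3}, let Ω ⊆ ℝ^d be a nonempty bounded open set, let b, c > 0 and T > 0. There exists C_T > 0 (depending on d, Ω, b, c, T) such that: if ψ is admissible, f : ℝ × ℝ^d → ℝ is continuous, v := ψ_t, and v_t − b Δv − c² Δψ = f on [0,T] × Ω, then sup_{t∈[0,T]}(‖v(t)‖² + t‖∇v(t)‖²) + ∫₀ᵀ(‖∇v(t)‖² + t‖v_t(t)‖²) dt ≤ C_T(‖ψ(0)‖_{H¹}² + ‖v(0)‖_{H¹}² + ∫₀ᵀ‖f(t)‖² dt + ∫₀ᵀ t‖f(t)‖² dt). -/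
open MeasureTheory Real

noncomputable section

/-- Euclidean space ℝ^d. -/
abbrev Spc (d : ℕ) := EuclideanSpace ℝ (Fin d)

variable {d : ℕ}

/-- Spatial Laplacian: sum of second derivatives in the coordinate directions. -/
def lap (g : Spc d → ℝ) (x : Spc d) : ℝ :=
  ∑ i, fderiv ℝ (fun y => fderiv ℝ g y (EuclideanSpace.single i 1)) x (EuclideanSpace.single i 1)

/-- Squared L²(Ω) norm: ‖g‖² = ∫_Ω g². -/
def sqL2 (Ω : Set (Spc d)) (g : Spc d → ℝ) : ℝ := ∫ x in Ω, (g x) ^ 2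

/-- Squared L²(Ω) norm of the gradient: ‖∇g‖² = ∫_Ω |∇g|². -/
def sqGrad (Ω : Set (Spc d)) (g : Spc d → ℝ) : ℝ := ∫ x in Ω, ‖gradient g x‖ ^ 2

/-- Squared L²(Ω) norm of the Hessian: ‖D²g‖² = ∫_Ω |D²g|². -/
def sqHess (Ω : Set (Spc d)) (g : Spc d → ℝ) : ℝ := ∫ x in Ω, ‖iteratedFDeriv ℝ 2 g x‖ ^ 2

/-- Squared H¹(Ω) norm. -/
def sqH1 (Ω : Set (Spc d)) (g : Spc d → ℝ) : ℝ := sqL2 Ω g + sqGrad Ω g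

/-- Squared H²(Ω) norm. -/
def sqH2 (Ω : Set (Spc d)) (g : Spc d → ℝ) : ℝ := sqL2 Ω g + sqGrad Ω g + sqHess Ω g

/-- H⁻¹(Ω) norm by duality against smooth compactly supported test functions. -/
def negH1 (Ω : Set (Spc d)) (g : Spc d → ℝ) : ℝ :=
  sSup { r : ℝ | ∃ φ : Spc d → ℝ, ContDiff ℝ (⊤ : ℕ∞) φ ∧ HasCompactSupport φ ∧ tsupport φ ⊆ Ω ∧
      (∫ x in Ω, ‖gradient φ x‖ ^ 2) ≤ 1 ∧ r = ∫ x in Ω, g x * φ x }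

/-- Admissible: smooth in (t,x), with spatial support in a fixed compact subset of Ω. -/
def Admissible (Ω : Set (Spc d)) (w : ℝ → Spc d → ℝ) : Prop :=
  ContDiff ℝ (⊤ : ℕ∞) (fun p : ℝ × Spc d => w p.1 p.2) ∧
  ∃ K : Set (Spc d), IsCompact K ∧ K ⊆ Ω ∧ ∀ t, Function.support (w t) ⊆ K

/-- Inner product of two spatial gradients: ∇g·∇h. -/
def gdot (g h : Spc d → ℝ) (x : Spc d) : ℝ := @inner ℝ _ _ (gradient g x) (gradient h x)

/-- Time derivative. -/
def tderiv (w : ℝ → Spc d → ℝ) (t : ℝ) (x : Spc d) : ℝ := deriv (fun s => w s x) t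

/-- The Blackstock equation ψ_tt − c²(1 − 2k ψ_t)Δψ − b Δψ_t + 2σ ∇ψ·∇ψ_t = 0
holds at time `t` on `Ω`. -/
def IsBlackstock (Ω : Set (Spc d)) (b c k σ : ℝ) (ψ : ℝ → Spc d → ℝ) (t : ℝ) : Prop :=
  ∀ x ∈ Ω,
    (tderiv (tderiv ψ) t x - c ^ 2 * (1 - 2 * k * tderiv ψ t x) * lap (ψ t) x
      - b * lap (tderiv ψ t) x
      + 2 * σ * gdot (ψ t) (tderiv ψ t) x) = 0

/-- Energy E(t). -/
def energy (Ω : Set (Spc d)) (b c : ℝ) (ψ : ℝ → Spc d → ℝ) (t : ℝ) : ℝ :=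
  (1 / 2) * sqL2 Ω (tderiv ψ t) + (c ^ 2 / 2) * sqGrad Ω (ψ t)
    + (c ^ 2 / (2 * b)) * sqL2 Ω (lap (ψ t)) + sqGrad Ω (tderiv ψ t)

/-- Dissipation D(t). -/
def dissip (Ω : Set (Spc d)) (ψ : ℝ → Spc d → ℝ) (t : ℝ) : ℝ :=
  ∫ s in (0:ℝ)..t,
    (sqGrad Ω (tderiv ψ s) + sqL2 Ω (lap (tderiv ψ s)) + sqGrad Ω (ψ s)
      + sqL2 Ω (lap (ψ s)) + sqL2 Ω (tderiv (tderiv ψ) s))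

/-- Supremum of a function of time over [0,T]. -/
def supIcc (T : ℝ) (f : ℝ → ℝ) : ℝ := ⨆ t : Set.Icc (0:ℝ) T, f t

/-- f := −2k c² ψ_t Δψ − 2σ ∇ψ·∇ψ_t, the right-hand side nonlinearity. -/
def blackF (c k σ : ℝ) (ψ : ℝ → Spc d → ℝ) (t : ℝ) (x : Spc d) : ℝ :=
  -(2 * k * c ^ 2) * tderiv ψ t x * lap (ψ t) x - 2 * σ * gdot (ψ t) (tderiv ψ t) x

/-- The nonlocal heat equation v_t − b Δv − c² Δψ = f (with v = ψ_t) holds at time `t` on `Ω`. -/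
def IsHeat (Ω : Set (Spc d)) (b c : ℝ) (ψ f : ℝ → Spc d → ℝ) (t : ℝ) : Prop :=
  ∀ x ∈ Ω,
    tderiv (tderiv ψ) t x - b * lap (tderiv ψ t) x - c ^ 2 * lap (ψ t) x = f t x

/-- The linearized Blackstock equation
ψ_tt − c²(1 − 2k α)Δψ − b Δψ_t + 2σ ∇ψ·∇α = f̃ holds at time `t` on `Ω`. -/
def IsLinBlackstock (Ω : Set (Spc d)) (b c k σ : ℝ) (α ψ f : ℝ → Spc d → ℝ) (t : ℝ) : Prop :=
  ∀ x ∈ Ω,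
    tderiv (tderiv ψ) t x - c ^ 2 * (1 - 2 * k * α t x) * lap (ψ t) x
      - b * lap (tderiv ψ t) x + 2 * σ * gdot (ψ t) (α t) x = f t x

/-- Time-weighted norm N_T^v for the velocity variable. -/
def normV (Ω : Set (Spc d)) (T : ℝ) (α : ℝ → Spc d → ℝ) : ℝ :=
  supIcc T (fun t => Real.sqrt (sqH1 Ω (α t)))
    + Real.sqrt (∫ t in (0:ℝ)..T, (sqL2 Ω (α t) + sqGrad Ω (α t) + sqL2 Ω (lap (α t))))
    + Real.sqrt (∫ t in (0:ℝ)..T, sqL2 Ω (tderiv α t))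
    + supIcc T (fun t => Real.sqrt t * Real.sqrt (sqL2 Ω (tderiv α t)))
    + Real.sqrt (∫ t in (0:ℝ)..T, t * sqGrad Ω (tderiv α t))
    + supIcc T (fun t => Real.sqrt t * Real.sqrt (sqL2 Ω (lap (α t))))

/-- Time-weighted solution norm N_T(ψ) = sup_{[0,T]} ‖ψ(t)‖_{H²} + N_T^v(ψ_t). -/
def normX (Ω : Set (Spc d)) (T : ℝ) (ψ : ℝ → Spc d → ℝ) : ℝ :=
  supIcc T (fun t => Real.sqrt (sqH2 Ω (ψ t))) + normV Ω T (tderiv ψ)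

/-! ### Helper lemmas -/

/-- Joint smoothness. -/
def Smo (w : ℝ → Spc d → ℝ) : Prop :=
  ContDiff ℝ (⊤ : ℕ∞) (fun p : ℝ × Spc d => w p.1 p.2)

/-- Partial derivative in the `i`-th direction. -/
def pd (i : Fin d) (w : ℝ → Spc d → ℝ) (t : ℝ) (x : Spc d) : ℝ :=
  fderiv ℝ (w t) x (EuclideanSpace.single i 1)

lemma Smo.tderiv_eq {w : ℝ → Spc d → ℝ} (h : Smo w) (t : ℝ) (x : Spc d) :
    HasDerivAt (fun s => w s x)
      (fderiv ℝ (fun p : ℝ × Spc d => w p.1 p.2) (t, x) (1, 0)) t := by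
  have h1 : HasFDerivAt (fun p : ℝ × Spc d => w p.1 p.2) _ (t, x) :=
    (h.differentiable (by simp) (t, x)).hasFDerivAt
  have h2 : HasDerivAt (fun s : ℝ => (s, x)) ((1 : ℝ), (0 : Spc d)) t :=
    (hasDerivAt_id t).prodMk (hasDerivAt_const t x)
  exact h1.comp_hasDerivAt t h2

lemma Smo.pd_eq {w : ℝ → Spc d → ℝ} (h : Smo w) (i : Fin d) (t : ℝ) (x : Spc d) :
    pd i w t x
      = fderiv ℝ (fun p : ℝ × Spc d => w p.1 p.2) (t, x) (0, EuclideanSpace.single i 1) := by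
  have h1 : HasFDerivAt (fun p : ℝ × Spc d => w p.1 p.2) _ (t, x) :=
    (h.differentiable (by simp) (t, x)).hasFDerivAt
  have h2 : HasFDerivAt (fun y : Spc d => (t, y)) _ x := hasFDerivAt_prodMk_right (𝕜 := ℝ) t x
  have h3 := (h1.comp x h2).fderiv
  have h4 : fderiv ℝ (w t) x = _ := h3
  simp [pd, h4]

lemma smo_dir {u : ℝ × Spc d → ℝ} (h : ContDiff ℝ (⊤ : ℕ∞) u) (v : ℝ × Spc d) :
    ContDiff ℝ (⊤ : ℕ∞) (fun p => fderiv ℝ u p v) := by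
  have : ContDiff ℝ (⊤ : ℕ∞) (fderiv ℝ u) := h.fderiv_right (by simp)
  exact this.clm_apply contDiff_const

lemma Smo.tderiv {w : ℝ → Spc d → ℝ} (h : Smo w) : Smo (tderiv w) := by
  have := smo_dir h (1, 0)
  have e : (fun p : ℝ × Spc d => _root_.tderiv w p.1 p.2)
      = fun p => fderiv ℝ (fun p : ℝ × Spc d => w p.1 p.2) p (1, 0) := by
    funext p; exact (h.tderiv_eq p.1 p.2).deriv
  unfold Smo
  rwa [e]

lemma Smo.pd {w : ℝ → Spc d → ℝ} (h : Smo w) (i : Fin d) : Smo (pd i w) := by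
  have := smo_dir h (0, EuclideanSpace.single i 1)
  have e : (fun p : ℝ × Spc d => _root_.pd i w p.1 p.2)
      = fun p => fderiv ℝ (fun p : ℝ × Spc d => w p.1 p.2) p (0, EuclideanSpace.single i 1) := by
    funext p; exact h.pd_eq i p.1 p.2
  unfold Smo
  rwa [e]

lemma Smo.hasDerivAt {w : ℝ → Spc d → ℝ} (h : Smo w) (t : ℝ) (x : Spc d) :
    HasDerivAt (fun s => w s x) (_root_.tderiv w t x) t :=
  (h.tderiv_eq t x).differentiableAt.hasDerivAt

lemma Smo.slice {w : ℝ → Spc d → ℝ} (h : Smo w) (t : ℝ) : ContDiff ℝ (⊤ : ℕ∞) (w t) :=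
  h.comp (contDiff_prodMk_right t)

lemma dir_comm {u : ℝ × Spc d → ℝ} (h : ContDiff ℝ (⊤ : ℕ∞) u) (v v' p : ℝ × Spc d) :
    fderiv ℝ (fun q => fderiv ℝ u q v) p v' = fderiv ℝ (fun q => fderiv ℝ u q v') p v := by
  have hs : IsSymmSndFDerivAt ℝ u p :=
    h.contDiffAt.isSymmSndFDerivAt (by
      rw [minSmoothness_of_isRCLikeNormedField]
      exact WithTop.coe_le_coe.2 (le_top : (2 : ℕ∞) ≤ ⊤))
  have hd : DifferentiableAt ℝ (fderiv ℝ u) p :=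
    (h.fderiv_right (m := (⊤ : ℕ∞)) (by simp)).differentiable (by simp) p
  rw [fderiv_clm_apply hd (differentiableAt_const _), fderiv_clm_apply hd (differentiableAt_const _)]
  simpa using hs.eq v' v

lemma Smo.comm {w : ℝ → Spc d → ℝ} (h : Smo w) (i : Fin d) :
    _root_.tderiv (_root_.pd i w) = _root_.pd i (_root_.tderiv w) := by
  funext t x
  rw [h.tderiv.pd_eq i t x]
  have h1 := ((h.pd i).tderiv_eq t x).deriv
  have e1 : (fun p : ℝ × Spc d => _root_.pd i w p.1 p.2)
      = fun p => fderiv ℝ (fun p : ℝ × Spc d => w p.1 p.2) p (0, EuclideanSpace.single i 1) := by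
    funext p; exact h.pd_eq i p.1 p.2
  have e2 : (fun p : ℝ × Spc d => _root_.tderiv w p.1 p.2)
      = fun p => fderiv ℝ (fun p : ℝ × Spc d => w p.1 p.2) p (1, 0) := by
    funext p; exact (h.tderiv_eq p.1 p.2).deriv
  rw [e1] at h1
  rw [e2]
  exact h1.trans (dir_comm h _ _ _)

lemma gdot_eq (g h : Spc d → ℝ) (x : Spc d) :
    gdot g h x = ∑ i, fderiv ℝ g x (EuclideanSpace.single i 1)
      * fderiv ℝ h x (EuclideanSpace.single i 1) := by
  have key : ∀ (g : Spc d → ℝ) (i : Fin d),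
      gradient g x i = fderiv ℝ g x (EuclideanSpace.single i 1) := by
    intro g i
    rw [← toDual_gradient, InnerProductSpace.toDual_apply_apply,
      EuclideanSpace.inner_single_right]
    simp only [conj_trivial, one_mul]
  unfold gdot
  rw [PiLp.inner_apply]
  refine Finset.sum_congr rfl fun i _ => ?_
  rw [key, key]
  simp [mul_comm]

lemma sqGrad_eq (Ω : Set (Spc d)) (g : Spc d → ℝ) : sqGrad Ω g = ∫ x in Ω, gdot g g x := by
  unfold sqGrad gdot
  simp only [real_inner_self_eq_norm_sq]

lemma gdot_comm (g h : Spc d → ℝ) (x : Spc d) : gdot g h x = gdot h g x := by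
  unfold gdot; exact real_inner_comm _ _

lemma Smo.gdot_eq {w z : ℝ → Spc d → ℝ} (t : ℝ) (x : Spc d) :
    gdot (w t) (z t) x = ∑ i, _root_.pd i w t x * _root_.pd i z t x :=
  _root_.gdot_eq _ _ _

lemma Smo.gdot {w z : ℝ → Spc d → ℝ} (hw : Smo w) (hz : Smo z) :
    Smo (fun t x => gdot (w t) (z t) x) := by
  unfold Smo
  simp only [Smo.gdot_eq]
  exact ContDiff.sum fun i _ => (hw.pd i).mul (hz.pd i)

lemma Smo.mul {w z : ℝ → Spc d → ℝ} (hw : Smo w) (hz : Smo z) :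
    Smo (fun t x => w t x * z t x) := ContDiff.mul hw hz

lemma tderiv_gdot {w z : ℝ → Spc d → ℝ} (hw : Smo w) (hz : Smo z) (t : ℝ) (x : Spc d) :
    tderiv (fun t x => gdot (w t) (z t) x) t x
      = gdot (tderiv w t) (z t) x + gdot (w t) (tderiv z t) x := by
  simp only [Smo.gdot_eq]
  have : HasDerivAt (fun s => ∑ i, pd i w s x * pd i z s x)
      (∑ i, (tderiv (pd i w) t x * pd i z t x + pd i w t x * tderiv (pd i z) t x)) t :=
    HasDerivAt.fun_sum fun i _ => ((hw.pd i).hasDerivAt t x).mul ((hz.pd i).hasDerivAt t x)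
  refine (this.deriv : _).trans ?_
  rw [Finset.sum_add_distrib]
  simp only [hw.comm, hz.comm]

lemma tderiv_mul {w z : ℝ → Spc d → ℝ} (hw : Smo w) (hz : Smo z) (t : ℝ) (x : Spc d) :
    tderiv (fun t x => w t x * z t x) t x
      = tderiv w t x * z t x + w t x * tderiv z t x :=
  ((hw.hasDerivAt t x).mul (hz.hasDerivAt t x)).deriv

lemma intOn {Ω : Set (Spc d)} (hbd : Bornology.IsBounded Ω) {g : Spc d → ℝ} (hg : Continuous g) :
    IntegrableOn g Ω :=
  (hg.continuousOn.integrableOn_compact hbd.isCompact_closure).mono_set subset_closure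

lemma cont_int {Ω : Set (Spc d)} (hbd : Bornology.IsBounded Ω) {w : ℝ → Spc d → ℝ}
    (hw : Continuous (fun p : ℝ × Spc d => w p.1 p.2)) :
    Continuous (fun t => ∫ x in Ω, w t x) := by
  have := continuous_parametric_integral_of_continuous (μ := volume.restrict Ω) (f := w) hw
    hbd.isCompact_closure
  have e : (volume.restrict Ω).restrict (closure Ω) = volume.restrict Ω := by
    rw [Measure.restrict_restrict isClosed_closure.measurableSet,
      Set.inter_eq_self_of_subset_right subset_closure]
  rwa [e] at this

lemma deriv_int {Ω : Set (Spc d)} (hbd : Bornology.IsBounded Ω) {w : ℝ → Spc d → ℝ}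
    (hw : Smo w) (t : ℝ) :
    HasDerivAt (fun t => ∫ x in Ω, w t x) (∫ x in Ω, tderiv w t x) t := by
  have hc : Continuous (fun p : ℝ × Spc d => tderiv w p.1 p.2) := hw.tderiv.continuous
  obtain ⟨M, hM⟩ := ((isCompact_Icc (a := t - 1) (b := t + 1)).prod
    hbd.isCompact_closure).exists_bound_of_continuousOn hc.continuousOn
  refine (hasDerivAt_integral_of_dominated_loc_of_deriv_le (s := Set.Icc (t - 1) (t + 1))
    (bound := fun _ => M) (Icc_mem_nhds (by linarith) (by linarith)) ?_ ?_ ?_ ?_ ?_ ?_).2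
  · exact Filter.Eventually.of_forall fun s => (hw.slice s).continuous.aestronglyMeasurable
  · exact intOn hbd (hw.slice t).continuous
  · exact (hw.tderiv.slice t).continuous.aestronglyMeasurable
  · have : ∀ᵐ x ∂(volume.restrict Ω), x ∈ closure Ω :=
      (ae_restrict_mem isClosed_closure.measurableSet).filter_mono
        (ae_mono (Measure.restrict_mono subset_closure le_rfl))
    filter_upwards [this] with x hx s hs
    exact hM (s, x) ⟨hs, hx⟩
  · exact intOn hbd continuous_const
  · exact Filter.Eventually.of_forall fun x s _ => hw.hasDerivAt s x

/-- Green formula against a compactly supported function. -/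
lemma green {Ω : Set (Spc d)} (hbd : Bornology.IsBounded Ω) {g h : Spc d → ℝ}
    (hg : ContDiff ℝ (⊤ : ℕ∞) g) (hh : ContDiff ℝ (⊤ : ℕ∞) h)
    {K : Set (Spc d)} (hK : IsCompact K) (hKΩ : K ⊆ Ω) (hs : Function.support h ⊆ K) :
    ∫ x in Ω, lap g x * h x = - ∫ x in Ω, gdot g h x := by
  have hts : tsupport h ⊆ K := closure_minimal hs hK.isClosed
  have hcs : HasCompactSupport h := HasCompactSupport.of_support_subset_isCompact hK hs
  have dir : ∀ {u : Spc d → ℝ} (_ : ContDiff ℝ (⊤ : ℕ∞) u) (v : Spc d),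
      ContDiff ℝ (⊤ : ℕ∞) (fun p => fderiv ℝ u p v) := by
    intro u hu v
    exact (hu.fderiv_right (m := (⊤ : ℕ∞)) (by simp)).clm_apply contDiff_const
  have h0 : ∀ x, x ∉ Ω → h x = 0 := fun x hx => by
    by_contra hne
    exact hx (hKΩ (hs hne))
  have h0' : ∀ x, x ∉ Ω → fderiv ℝ h x = 0 := fun x hx => by
    by_contra hne
    exact hx (hKΩ (hts (support_fderiv_subset ℝ hne)))
  have hcs' : ∀ v, HasCompactSupport (fun x => fderiv ℝ h x v) := fun v =>
    hcs.fderiv_apply ℝ v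
  simp only [gdot_eq, lap, Finset.sum_mul]
  rw [setIntegral_eq_integral_of_forall_compl_eq_zero, setIntegral_eq_integral_of_forall_compl_eq_zero]
  rotate_left
  · intro x hx; simp [h0' x hx]
  · intro x hx; simp [h0 x hx]
  have i1 : ∀ i : Fin d, Integrable (fun x => fderiv ℝ
      (fun y => fderiv ℝ g y (EuclideanSpace.single i 1)) x (EuclideanSpace.single i 1) * h x) :=
    fun i => ((dir (dir hg _) _).continuous.mul hh.continuous).integrable_of_hasCompactSupport
      hcs.mul_left
  have i2 : ∀ i : Fin d, Integrable (fun x => fderiv ℝ g x (EuclideanSpace.single i 1)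
      * fderiv ℝ h x (EuclideanSpace.single i 1)) :=
    fun i => ((dir hg _).continuous.mul (dir hh _).continuous).integrable_of_hasCompactSupport
      (hcs' _).mul_left
  rw [integral_finsetSum _ fun i _ => i1 i, integral_finsetSum _ fun i _ => i2 i,
    ← Finset.sum_neg_distrib]
  refine Finset.sum_congr rfl fun i _ => ?_
  rw [integral_mul_fderiv_eq_neg_fderiv_mul_of_integrable (i1 i) (i2 i), neg_neg]
  · exact ((dir hg _).continuous.mul hh.continuous).integrable_of_hasCompactSupport hcs.mul_left
  · exact fun x _ => (dir hg _).differentiable (by simp) x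
  · exact fun x _ => hh.differentiable (by simp) x

lemma Smo.lap_eq (w : ℝ → Spc d → ℝ) (t : ℝ) (x : Spc d) :
    lap (w t) x = ∑ i, _root_.pd i (_root_.pd i w) t x := rfl

lemma Smo.lap {w : ℝ → Spc d → ℝ} (hw : Smo w) : Smo (fun t x => lap (w t) x) := by
  unfold Smo
  simp only [Smo.lap_eq]
  exact ContDiff.sum fun i _ => ((hw.pd i).pd i)

lemma supp_tderiv {w : ℝ → Spc d → ℝ} {K : Set (Spc d)} (h : ∀ t, Function.support (w t) ⊆ K)
    (t : ℝ) : Function.support (tderiv w t) ⊆ K := by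
  intro x hx
  by_contra hxK
  apply hx
  have : (fun s => w s x) = fun _ => 0 := by
    funext s
    by_contra hne
    exact hxK (h s hne)
  simp [tderiv, this]

/-- Weak form. -/
lemma weak {Ω : Set (Spc d)} (hop : IsOpen Ω) (hbd : Bornology.IsBounded Ω) {b c : ℝ}
    {ψ f : ℝ → Spc d → ℝ} (hψ : Smo ψ) {t : ℝ} (hh : IsHeat Ω b c ψ f t)
    {h : Spc d → ℝ} (hsm : ContDiff ℝ (⊤ : ℕ∞) h)
    {K : Set (Spc d)} (hK : IsCompact K) (hKΩ : K ⊆ Ω) (hs : Function.support h ⊆ K) :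
    ∫ x in Ω, f t x * h x = (∫ x in Ω, tderiv (tderiv ψ) t x * h x)
      + b * (∫ x in Ω, gdot (tderiv ψ t) h x) + c ^ 2 * ∫ x in Ω, gdot (ψ t) h x := by
  have g1 := green hbd (hψ.tderiv.slice t) hsm hK hKΩ hs
  have g2 := green hbd (hψ.slice t) hsm hK hKΩ hs
  have e : ∫ x in Ω, f t x * h x = ∫ x in Ω, (tderiv (tderiv ψ) t x * h x
      - b * (lap (tderiv ψ t) x * h x) - c ^ 2 * (lap (ψ t) x * h x)) := by
    refine setIntegral_congr_fun hop.measurableSet fun x hx => ?_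
    simp only [← hh x hx]
    ring
  have j1 : IntegrableOn (fun x => tderiv (tderiv ψ) t x * h x) Ω :=
    intOn hbd ((hψ.tderiv.tderiv.slice t).continuous.mul hsm.continuous)
  have j2 : IntegrableOn (fun x => b * (lap (tderiv ψ t) x * h x)) Ω :=
    intOn hbd (continuous_const.mul ((hψ.tderiv.lap.slice t).continuous.mul hsm.continuous))
  have j3 : IntegrableOn (fun x => c ^ 2 * (lap (ψ t) x * h x)) Ω :=
    intOn hbd (continuous_const.mul ((hψ.lap.slice t).continuous.mul hsm.continuous))
  have j12 : IntegrableOn (fun x => tderiv (tderiv ψ) t x * h x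
      - b * (lap (tderiv ψ t) x * h x)) Ω := j1.sub j2
  rw [e, integral_sub j12 j3, integral_sub j1 j2, integral_const_mul, integral_const_mul,
    g1, g2]
  ring

set_option maxHeartbeats 4000000 in
/-- Abstract ODE energy argument. -/
lemma energy_ode (b c T : ℝ) (hb : 0 < b) (hT : 0 < T) :
    ∃ C > (0:ℝ), ∀ A P V Q W F R S a₁ a₂ : ℝ → ℝ,
      (∀ t, 0 ≤ A t) → (∀ t, 0 ≤ P t) → (∀ t, 0 ≤ V t) → (∀ t, 0 ≤ W t) → (∀ t, 0 ≤ F t) →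
      Continuous W → Continuous F →
      (∀ t, HasDerivAt P (2 * Q t) t) → (∀ t, HasDerivAt V (2 * R t) t) →
      (∀ t, HasDerivAt Q (V t + S t) t) →
      (∀ t, ∃ A', HasDerivAt A (2 * A') t ∧
        (t ∈ Set.Icc 0 T → a₁ t = A' + b * V t + c ^ 2 * Q t)) →
      (∀ t ∈ Set.Icc 0 T, a₂ t = W t + b * R t + c ^ 2 * S t) →
      (∀ t, 2 * a₁ t ≤ F t + A t) → (∀ t, 2 * a₂ t ≤ F t + W t) →
      (∀ t r, 0 ≤ P t + 2 * r * Q t + r ^ 2 * V t) →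
      (∀ t ∈ Set.Icc 0 T, A t + t * V t + (∫ s in (0:ℝ)..T, (V s + s * W s))
        ≤ C * (A 0 + P 0 + (∫ s in (0:ℝ)..T, F s) + ∫ s in (0:ℝ)..T, s * F s)) := by
  obtain ⟨M, hM1, hM2, hM3⟩ : ∃ M : ℝ, 1 ≤ M ∧ b / 2 + c ^ 2 / 2 + c ^ 2 * T ≤ b * M ∧
      2 * c ^ 2 * T ≤ b * M := by
    refine ⟨1 + (b / 2 + c ^ 2 / 2 + c ^ 2 * T + 2 * c ^ 2 * T) / b, ?_, ?_, ?_⟩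
    · have : 0 ≤ (b / 2 + c ^ 2 / 2 + c ^ 2 * T + 2 * c ^ 2 * T) / b := by positivity
      linarith
    · rw [mul_add, mul_div_cancel₀ _ hb.ne']
      nlinarith [mul_nonneg (sq_nonneg c) hT.le]
    · rw [mul_add, mul_div_cancel₀ _ hb.ne']
      nlinarith [mul_nonneg (sq_nonneg c) hT.le, sq_nonneg c]
  have hM0 : 0 < M := by linarith
  refine ⟨(2 + 4 / b + (1 / b + 2)) * exp (3 * T) * (M * (1 + c ^ 2)), by positivity, ?_⟩
  intro A P V Q W F R S a₁ a₂ hA hP hV hW hF cW cF dP dV dQ dA ha₂ h1 h2 hQ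
  have cA : Continuous A := continuous_iff_continuousAt.2 fun t => by
    obtain ⟨A', h, -⟩ := dA t
    exact h.continuousAt
  have cV : Continuous V := continuous_iff_continuousAt.2 fun t => (dV t).continuousAt
  -- functional
  set Y : ℝ → ℝ := fun t => M * (A t + c ^ 2 * P t) + (b / 2 * (t * V t) + c ^ 2 * (t * Q t)) with hY
  set φ : ℝ → ℝ := fun s => exp (-(3 * T)) * (b * M * V s + s * W s / 2) - M * (F s + s * F s) with hφ
  have cφ : Continuous φ := by fun_prop
  have Ylow : ∀ t ∈ Set.Icc 0 T, M / 2 * (A t + c ^ 2 * P t) + b / 4 * (t * V t) ≤ Y t := by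
    intro t ht
    simp only [hY]
    have hq := hQ t (b / (2 * c ^ 2))
    -- c ^ 2 * Q ≥ - (b / 4) * V - (c ^ 4 / b) * P
    have hq' : 0 ≤ c ^ 4 / b * P t + c ^ 2 * Q t + b / 4 * V t := by
      by_cases hc : c = 0
      · subst hc
        have := hV t
        simp; positivity
      · have : c ^ 4 / b * P t + c ^ 2 * Q t + b / 4 * V t
            = c ^ 4 / b * (P t + 2 * (b / (2 * c ^ 2)) * Q t + (b / (2 * c ^ 2)) ^ 2 * V t) := by
          field_simp
          ring
        rw [this]; positivity
    have h3 := mul_nonneg ht.1 hq'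
    have h4 : t * (c ^ 4 / b * P t) ≤ M / 2 * (c ^ 2 * P t) := by
      have : c ^ 2 * t / b ≤ M / 2 := by
        rw [div_le_iff₀ hb]
        nlinarith [mul_le_mul_of_nonneg_left ht.2 (sq_nonneg c)]
      have h5 := mul_le_mul_of_nonneg_right this (mul_nonneg (sq_nonneg c) (hP t))
      calc t * (c ^ 4 / b * P t) = c ^ 2 * t / b * (c ^ 2 * P t) := by ring
        _ ≤ _ := h5
    nlinarith [mul_nonneg hM0.le (hA t)]
  have dY : ∀ t ∈ Set.Icc 0 T, ∃ Y', HasDerivAt Y Y' t ∧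
      Y' ≤ 3 * Y t + M * (F t + t * F t) - (b * M * V t + t * W t / 2) := by
    intro t ht
    obtain ⟨A', hA', ea⟩ := dA t
    have hd : HasDerivAt Y (M * (2 * A' + c ^ 2 * (2 * Q t)) +
        (b / 2 * (1 * V t + t * (2 * R t)) + c ^ 2 * (1 * Q t + t * (V t + S t)))) t := by
      exact ((hA'.add ((dP t).const_mul _)).const_mul M).add
        ((((hasDerivAt_id t).mul (dV t)).const_mul (b / 2)).add
          (((hasDerivAt_id t).mul (dQ t)).const_mul (c ^ 2)))
    refine ⟨_, hd, ?_⟩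
    have ea := ea ht
    have eb := ha₂ t ht
    have low := Ylow t ht
    have k1 := mul_le_mul_of_nonneg_left (h1 t) hM0.le
    have k2 := mul_le_mul_of_nonneg_left (h2 t) ht.1
    have k3 := mul_nonneg (sq_nonneg c) (hQ t (-1))
    have k4 : c ^ 2 * t * V t ≤ c ^ 2 * T * V t :=
      mul_le_mul_of_nonneg_right (mul_le_mul_of_nonneg_left ht.2 (sq_nonneg c)) (hV t)
    have k5 := mul_le_mul_of_nonneg_right hM2 (hV t)
    have k6 : c ^ 2 * P t ≤ M * (c ^ 2 * P t) := by
      nlinarith [mul_nonneg (sq_nonneg c) (hP t)]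
    have k7 := mul_nonneg ht.1 (hF t)
    have k8 : t * F t ≤ M * (t * F t) := by nlinarith
    have k9 := mul_nonneg hM0.le (hA t)
    have k10 := mul_nonneg hb.le (mul_nonneg ht.1 (hV t))
    have k11 := mul_nonneg (sq_nonneg c) (hP t)
    have e1 : A' = a₁ t - b * V t - c ^ 2 * Q t := by linarith
    have e2 : t * (b * R t) + t * (c ^ 2 * S t) = t * a₂ t - t * W t := by rw [eb]; ring
    rw [e1]
    nlinarith
  set H : ℝ → ℝ := fun t => exp (-(3 * t)) * Y t + ∫ s in (0:ℝ)..t, φ s with hH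
  have dH : ∀ t ∈ Set.Icc 0 T, ∃ H', HasDerivAt H H' t ∧ H' ≤ 0 := by
    intro t ht
    obtain ⟨Y', hY', le⟩ := dY t ht
    have he : HasDerivAt (fun t : ℝ => exp (-(3 * t))) (exp (-(3 * t)) * (-(3 * 1))) t :=
      (((hasDerivAt_id t).const_mul 3).neg).exp
    have hi : HasDerivAt (fun t => ∫ s in (0:ℝ)..t, φ s) (φ t) t :=
      cφ.integral_hasStrictDerivAt 0 t |>.hasDerivAt
    refine ⟨_, (he.mul hY').add hi, ?_⟩
    simp only [hφ]
    have E0 := exp_pos (-(3 * t))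
    have E1 : exp (-(3 * t)) ≤ 1 := exp_le_one_iff.2 (by linarith [ht.1])
    have E2 : exp (-(3 * T)) ≤ exp (-(3 * t)) := exp_le_exp.2 (by linarith [ht.2])
    have g1 : 0 ≤ M * (F t + t * F t) := by
      have := hF t
      have := ht.1
      positivity
    have g2 : 0 ≤ b * M * V t + t * W t / 2 := by
      have := hV t
      have := hW t
      have := ht.1
      positivity
    nlinarith [mul_le_mul_of_nonneg_left le E0.le, mul_le_mul_of_nonneg_right E1 g1,
      mul_le_mul_of_nonneg_right E2 g2]
  have anti : AntitoneOn H (Set.Icc 0 T) := by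
    refine antitoneOn_of_deriv_nonpos (convex_Icc 0 T) ?_ ?_ ?_
    · intro t ht
      obtain ⟨H', h, -⟩ := dH t ht
      exact h.continuousAt.continuousWithinAt
    · intro t ht
      obtain ⟨H', h, -⟩ := dH t (interior_subset ht)
      exact h.differentiableAt.differentiableWithinAt
    · intro t ht
      obtain ⟨H', h, h'⟩ := dH t (interior_subset ht)
      rwa [h.deriv]
  set D : ℝ := M * (A 0 + c ^ 2 * P 0) + M * ((∫ s in (0:ℝ)..T, F s) + ∫ s in (0:ℝ)..T, s * F s)
    with hD
  have main : ∀ t ∈ Set.Icc 0 T, exp (-(3 * t)) * Y t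
      + exp (-(3 * T)) * (∫ s in (0:ℝ)..t, (b * M * V s + s * W s / 2)) ≤ D := by
    intro t ht
    have h := anti (Set.left_mem_Icc.2 hT.le) ht ht.1
    simp only [hH, intervalIntegral.integral_same] at h
    have hi : ∫ s in (0:ℝ)..t, φ s = exp (-(3 * T)) * (∫ s in (0:ℝ)..t, (b * M * V s + s * W s / 2))
        - M * ∫ s in (0:ℝ)..t, (F s + s * F s) := by
      simp only [hφ]
      rw [intervalIntegral.integral_sub, intervalIntegral.integral_const_mul,
        intervalIntegral.integral_const_mul]
      · exact Continuous.intervalIntegrable (by fun_prop) _ _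
      · exact Continuous.intervalIntegrable (by fun_prop) _ _
    have hm : ∫ s in (0:ℝ)..t, (F s + s * F s) ≤ ∫ s in (0:ℝ)..T, (F s + s * F s) := by
      refine intervalIntegral.integral_mono_interval le_rfl ht.1 ht.2 ?_
        (Continuous.intervalIntegrable (by fun_prop) _ _)
      filter_upwards [ae_restrict_mem measurableSet_Ioc] with s hs
      have := hF s
      have := hs.1.le
      simp only [Pi.zero_apply]
      positivity
    have hs : ∫ s in (0:ℝ)..T, (F s + s * F s)
        = (∫ s in (0:ℝ)..T, F s) + ∫ s in (0:ℝ)..T, s * F s :=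
      intervalIntegral.integral_add (cF.intervalIntegrable _ _)
        (Continuous.intervalIntegrable (by fun_prop) _ _)
    have hY0 : exp (-(3 * 0)) * Y 0 = M * (A 0 + c ^ 2 * P 0) := by simp [hY]
    have hm' := mul_le_mul_of_nonneg_left hm hM0.le
    rw [hY0, hi] at h
    rw [hs] at hm'
    simp only [hD]
    linarith
  have nonneg_int : ∀ t ∈ Set.Icc 0 T, 0 ≤ ∫ s in (0:ℝ)..t, (b * M * V s + s * W s / 2) := by
    intro t ht
    refine intervalIntegral.integral_nonneg ht.1 fun s hs => ?_
    have := hV s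
    have := hW s
    have := hs.1
    positivity
  have Y0 : ∀ t ∈ Set.Icc 0 T, 0 ≤ Y t := fun t ht => le_trans (by
    have := hA t
    have := hP t
    have := hV t
    have := ht.1
    positivity) (Ylow t ht)
  have eT : exp (3 * T) * exp (-(3 * T)) = 1 := by rw [← exp_add]; simp
  have EP := exp_pos (3 * T)
  have D0 : D ≤ M * (1 + c ^ 2) * (A 0 + P 0 + (∫ s in (0:ℝ)..T, F s) + ∫ s in (0:ℝ)..T, s * F s) := by
    have i1 : 0 ≤ ∫ s in (0:ℝ)..T, F s := intervalIntegral.integral_nonneg hT.le fun s _ => hF s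
    have i2 : 0 ≤ ∫ s in (0:ℝ)..T, s * F s :=
      intervalIntegral.integral_nonneg hT.le fun s hs => mul_nonneg hs.1 (hF s)
    have : A 0 + c ^ 2 * P 0 + ((∫ s in (0:ℝ)..T, F s) + ∫ s in (0:ℝ)..T, s * F s) ≤ (1 + c ^ 2) * (A 0 + P 0 + (∫ s in (0:ℝ)..T, F s) + ∫ s in (0:ℝ)..T, s * F s) := by
      nlinarith [hA 0, hP 0, mul_nonneg (sq_nonneg c) (hA 0), mul_nonneg (sq_nonneg c) i1,
        mul_nonneg (sq_nonneg c) i2]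
    have := mul_le_mul_of_nonneg_left this hM0.le
    simp only [hD]
    nlinarith
  intro t ht
  have B1 : A t + t * V t ≤ (2 + 4 / b) * (exp (3 * T) * D) := by
    have m := main t ht
    have n := mul_nonneg (exp_pos (-(3 * T))).le (nonneg_int t ht)
    have E2 : exp (-(3 * T)) ≤ exp (-(3 * t)) := exp_le_exp.2 (by linarith [ht.2])
    have m2 : exp (-(3 * T)) * Y t ≤ D := by
      have := mul_le_mul_of_nonneg_right E2 (Y0 t ht)
      linarith
    have m3 : Y t ≤ exp (3 * T) * D := by
      have := mul_le_mul_of_nonneg_left m2 EP.le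
      rwa [← mul_assoc, eT, one_mul] at this
    have low := Ylow t ht
    have y0 := Y0 t ht
    have tv := mul_nonneg ht.1 (hV t)
    have cp := mul_nonneg (sq_nonneg c) (hP t)
    have q1 : A t ≤ 2 * Y t := by
      nlinarith [mul_nonneg hb.le tv, hA t, mul_nonneg hM0.le cp,
        mul_nonneg (sub_nonneg.2 hM1) (hA t)]
    have q2 : t * V t ≤ 4 / b * Y t := by
      rw [div_mul_eq_mul_div, le_div_iff₀ hb]
      nlinarith [mul_nonneg hM0.le cp, mul_nonneg hM0.le (hA t)]
    have : (2 + 4 / b) * Y t ≤ (2 + 4 / b) * (exp (3 * T) * D) :=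
      mul_le_mul_of_nonneg_left m3 (by positivity)
    linarith
  have B2 : ∫ s in (0:ℝ)..T, (V s + s * W s) ≤ (1 / b + 2) * (exp (3 * T) * D) := by
    have hTm : T ∈ Set.Icc 0 T := Set.right_mem_Icc.2 hT.le
    have m := main T hTm
    have n := mul_nonneg (exp_pos (-(3 * T))).le (Y0 T hTm)
    have m2 : exp (-(3 * T)) * (∫ s in (0:ℝ)..T, (b * M * V s + s * W s / 2)) ≤ D := by linarith
    have m3 : (∫ s in (0:ℝ)..T, (b * M * V s + s * W s / 2)) ≤ exp (3 * T) * D := by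
      have := mul_le_mul_of_nonneg_left m2 EP.le
      rwa [← mul_assoc, eT, one_mul] at this
    have le : ∫ s in (0:ℝ)..T, (V s + s * W s)
        ≤ ∫ s in (0:ℝ)..T, (1 / b + 2) * (b * M * V s + s * W s / 2) := by
      refine intervalIntegral.integral_mono_on hT.le
        (Continuous.intervalIntegrable (by fun_prop) _ _)
        (Continuous.intervalIntegrable (by fun_prop) _ _) fun s hs => ?_
      have sw := mul_nonneg hs.1 (hW s)
      have e : (1 / b + 2) * (b * M * V s + s * W s / 2)
          = M * V s + 1 / b * (s * W s / 2) + 2 * (b * M * V s) + s * W s := by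
        field_simp
        ring
      rw [e]
      have p1 : 0 ≤ 1 / b * (s * W s / 2) := by positivity
      have p2 : 0 ≤ 2 * (b * M * V s) := by
        have := hV s
        positivity
      nlinarith [hV s]
    rw [intervalIntegral.integral_const_mul] at le
    exact le.trans (mul_le_mul_of_nonneg_left m3 (by positivity))
  have D1 := mul_le_mul_of_nonneg_left D0
    (show 0 ≤ (2 + 4 / b + (1 / b + 2)) * exp (3 * T) by positivity)
  calc _ ≤ (2 + 4 / b + (1 / b + 2)) * exp (3 * T) * D := by linarith
    _ ≤ _ := D1
    _ = _ := by ring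

/-- time-weighted energy estimate for the nonlocal heat equation. -/
theorem heat_weighted_estimate (d : ℕ) (hd : d = 1 ∨ d = 2 ∨ d = 3)
    (Ω : Set (Spc d)) (hne : Ω.Nonempty) (hop : IsOpen Ω) (hbd : Bornology.IsBounded Ω)
    (b c : ℝ) (hb : 0 < b) (hc : 0 < c) (T : ℝ) (hT : 0 < T) :
    ∃ C > (0:ℝ),
      ∀ ψ f : ℝ → Spc d → ℝ, Admissible Ω ψ →
        Continuous (fun p : ℝ × Spc d => f p.1 p.2) →
        (∀ t ∈ Set.Icc (0:ℝ) T, IsHeat Ω b c ψ f t) →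
        supIcc T (fun t => sqL2 Ω (tderiv ψ t) + t * sqGrad Ω (tderiv ψ t))
          + (∫ t in (0:ℝ)..T, (sqGrad Ω (tderiv ψ t) + t * sqL2 Ω (tderiv (tderiv ψ) t)))
        ≤ C * (sqH1 Ω (ψ 0) + sqH1 Ω (tderiv ψ 0)
            + (∫ t in (0:ℝ)..T, sqL2 Ω (f t)) + ∫ t in (0:ℝ)..T, t * sqL2 Ω (f t)) := by
  obtain ⟨C, hC, key⟩ := energy_ode b c T hb hT
  refine ⟨C, hC, ?_⟩
  intro ψ f hadm hf hheat
  obtain ⟨hψ', K, hK, hKΩ, hsupp⟩ := hadm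
  have hψ : Smo ψ := hψ'
  have hv : Smo (tderiv ψ) := hψ.tderiv
  have hvt : Smo (tderiv (tderiv ψ)) := hv.tderiv
  have fs : ∀ t, Continuous (f t) := fun t => hf.comp (Continuous.prodMk_right t)
  have cs : ∀ {w : ℝ → Spc d → ℝ}, Smo w → ∀ t, Continuous (w t) := fun h t => (h.slice t).continuous
  have young : ∀ g h : Spc d → ℝ, Continuous g → Continuous h →
      2 * (∫ x in Ω, g x * h x) ≤ sqL2 Ω g + sqL2 Ω h := by
    intro g h hg hh
    unfold sqL2
    have j1 : IntegrableOn (fun x => g x ^ 2) Ω := intOn hbd (hg.pow 2)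
    have j2 : IntegrableOn (fun x => h x ^ 2) Ω := intOn hbd (hh.pow 2)
    rw [← integral_const_mul, ← integral_add j1 j2]
    refine integral_mono (intOn hbd (continuous_const.mul (hg.mul hh))) (j1.add j2) fun x => ?_
    simp only
    nlinarith [sq_nonneg (g x - h x)]
  have res := key (fun t => sqL2 Ω (tderiv ψ t)) (fun t => sqGrad Ω (ψ t))
    (fun t => sqGrad Ω (tderiv ψ t)) (fun t => ∫ x in Ω, gdot (ψ t) (tderiv ψ t) x)
    (fun t => sqL2 Ω (tderiv (tderiv ψ) t)) (fun t => sqL2 Ω (f t))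
    (fun t => ∫ x in Ω, gdot (tderiv ψ t) (tderiv (tderiv ψ) t) x)
    (fun t => ∫ x in Ω, gdot (ψ t) (tderiv (tderiv ψ) t) x)
    (fun t => ∫ x in Ω, f t x * tderiv ψ t x)
    (fun t => ∫ x in Ω, f t x * tderiv (tderiv ψ) t x)
    (fun t => integral_nonneg fun x => sq_nonneg _)
    (fun t => integral_nonneg fun x => sq_nonneg _)
    (fun t => integral_nonneg fun x => sq_nonneg _)
    (fun t => integral_nonneg fun x => sq_nonneg _)
    (fun t => integral_nonneg fun x => sq_nonneg _)
    (cont_int hbd (w := fun t x => tderiv (tderiv ψ) t x ^ 2) (hvt.continuous.pow 2))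
    (cont_int hbd (w := fun t x => f t x ^ 2) (hf.pow 2))
    ?_ ?_ ?_ ?_ ?_ ?_ ?_ ?_
  · have hTm : (0:ℝ) ∈ Set.Icc 0 T := Set.left_mem_Icc.2 hT.le
    have : Nonempty (Set.Icc (0:ℝ) T) := ⟨⟨0, hTm⟩⟩
    have hb1 : sqL2 Ω (tderiv ψ 0) + sqGrad Ω (ψ 0) ≤ sqH1 Ω (ψ 0) + sqH1 Ω (tderiv ψ 0) := by
      unfold sqH1
      have : 0 ≤ sqL2 Ω (ψ 0) := integral_nonneg fun x => sq_nonneg _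
      have : 0 ≤ sqGrad Ω (tderiv ψ 0) := integral_nonneg fun x => sq_nonneg _
      linarith
    refine le_trans ?_ (mul_le_mul_of_nonneg_left (add_le_add_left (add_le_add_left hb1 _) _) hC.le)
    rw [← le_sub_iff_add_le]
    refine ciSup_le fun t => ?_
    rw [le_sub_iff_add_le]
    exact res t.1 t.2
  · intro t
    simp only [sqGrad_eq]
    refine (deriv_int hbd (hψ.gdot hψ) t).congr_deriv ?_
    rw [← integral_const_mul]
    congr 1; funext x
    rw [tderiv_gdot hψ hψ, gdot_comm (tderiv ψ t)]; ring
  · intro t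
    simp only [sqGrad_eq]
    refine (deriv_int hbd (hv.gdot hv) t).congr_deriv ?_
    rw [← integral_const_mul]
    congr 1; funext x
    rw [tderiv_gdot hv hv, gdot_comm (tderiv (tderiv ψ) t)]; ring
  · intro t
    simp only [sqGrad_eq]
    refine (deriv_int hbd (hψ.gdot hv) t).congr_deriv ?_
    rw [← integral_add (intOn hbd (cs (hv.gdot hv) t)) (intOn hbd (cs (hψ.gdot hvt) t))]
    congr 1; funext x
    rw [tderiv_gdot hψ hv]
  · intro t
    refine ⟨∫ x in Ω, tderiv (tderiv ψ) t x * tderiv ψ t x, ?_, ?_⟩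
    · simp only [sqL2, pow_two]
      refine (deriv_int hbd (hv.mul hv) t).congr_deriv ?_
      rw [← integral_const_mul]
      congr 1; funext x
      rw [tderiv_mul hv hv]; ring
    · intro ht
      simp only [sqGrad_eq]
      exact weak hop hbd hψ (hheat t ht) (hv.slice t) hK hKΩ (supp_tderiv hsupp t)
  · intro t ht
    simp only [sqL2, pow_two (tderiv (tderiv ψ) t _)]
    exact weak hop hbd hψ (hheat t ht) (hvt.slice t) hK hKΩ (supp_tderiv (supp_tderiv hsupp) t)
  · exact fun t => young _ _ (fs t) (cs hv t)
  · exact fun t => young _ _ (fs t) (cs hvt t)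
  · intro t r
    simp only [sqGrad_eq]
    have j1 : IntegrableOn (fun x => gdot (ψ t) (ψ t) x) Ω := intOn hbd (cs (hψ.gdot hψ) t)
    have j2 : IntegrableOn (fun x => 2 * r * gdot (ψ t) (tderiv ψ t) x) Ω :=
      intOn hbd (continuous_const.mul (cs (hψ.gdot hv) t))
    have j3 : IntegrableOn (fun x => r ^ 2 * gdot (tderiv ψ t) (tderiv ψ t) x) Ω :=
      intOn hbd (continuous_const.mul (cs (hv.gdot hv) t))
    have j12 : IntegrableOn (fun x => gdot (ψ t) (ψ t) x
      + 2 * r * gdot (ψ t) (tderiv ψ t) x) Ω := j1.add j2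
    rw [← integral_const_mul, ← integral_const_mul, ← integral_add j1 j2, ← integral_add j12 j3]
    refine integral_nonneg fun x => ?_
    simp only [gdot_eq, Finset.mul_sum, ← Finset.sum_add_distrib, Pi.zero_apply]
    refine Finset.sum_nonneg fun i _ => ?_
    nlinarith [sq_nonneg (fderiv ℝ (ψ t) x (EuclideanSpace.single i 1)
      + r * fderiv ℝ (tderiv ψ t) x (EuclideanSpace.single i 1))]
end
end

section
/- Let d ∈ {1,2,3}, let Ω ⊆ ℝ^d be a nonempty bounded open set, let b, c > 0 and T > 0. There exists C_T > 0 (depending on d, Ω, b, c, T) such that: if ψ is admissible, f : ℝ × ℝ^d → ℝ is continuous, v := ψ_t, and v_t − b Δv − c² Δψ = f on [0,T] × Ω, then sup_{t∈[0,T]}(‖ψ(t)‖_{H¹}² + ‖Δψ(t)‖²) + ∫₀ᵀ(‖v(t)‖_{H¹}² + ‖Δv(t)‖²) dt ≤ C_T(‖ψ(0)‖_{H²}² + ‖v(0)‖_{H¹}² + ∫₀ᵀ‖f(t)‖² dt). -/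
open MeasureTheory Real

noncomputable section

variable {d : ℕ}

/-- Smooth in spacetime with spatial support in `K`. -/
def HS (K : Set (Spc d)) (u : ℝ × Spc d → ℝ) : Prop :=
  ContDiff ℝ (⊤ : ℕ∞) u ∧ ∀ p, p.2 ∉ K → u p = 0

/-- Directional derivative in spacetime. -/
def Dd (e : ℝ × Spc d) (u : ℝ × Spc d → ℝ) (p : ℝ × Spc d) : ℝ := fderiv ℝ u p e

/-- Spatial Laplacian on spacetime functions. -/
def LL (u : ℝ × Spc d → ℝ) (p : ℝ × Spc d) : ℝ :=
  ∑ i, Dd (0, EuclideanSpace.single i 1) (Dd (0, EuclideanSpace.single i 1) u) p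

lemma HS.diff {K : Set (Spc d)} {u : ℝ × Spc d → ℝ} (h : HS K u) : Differentiable ℝ u :=
  h.1.differentiable (by simp)

lemma HS.D {K : Set (Spc d)} (hK : IsClosed K) {u : ℝ × Spc d → ℝ} (h : HS K u)
    (e : ℝ × Spc d) : HS K (Dd e u) := by
  refine ⟨?_, ?_⟩
  · have : ContDiff ℝ (⊤ : ℕ∞) (fderiv ℝ u) := h.1.fderiv_right (by simp)
    exact this.clm_apply contDiff_const
  · intro p hp
    have : u =ᶠ[nhds p] (fun _ => 0) := by
      have ho : IsOpen {q : ℝ × Spc d | q.2 ∉ K} := hK.isOpen_compl.preimage continuous_snd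
      filter_upwards [ho.mem_nhds hp] with q hq using h.2 q hq
    simp [Dd, this.fderiv_eq]

lemma HS.add {K : Set (Spc d)} {u w : ℝ × Spc d → ℝ} (h : HS K u) (h' : HS K w) :
    HS K (fun p => u p + w p) :=
  ⟨h.1.add h'.1, fun p hp => by simp [h.2 p hp, h'.2 p hp]⟩

lemma HS.sub {K : Set (Spc d)} {u w : ℝ × Spc d → ℝ} (h : HS K u) (h' : HS K w) :
    HS K (fun p => u p - w p) :=
  ⟨h.1.sub h'.1, fun p hp => by simp [h.2 p hp, h'.2 p hp]⟩

lemma HS.mul {K : Set (Spc d)} {u w : ℝ × Spc d → ℝ} (h : HS K u) (h' : HS K w) :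
    HS K (fun p => u p * w p) :=
  ⟨h.1.mul h'.1, fun p hp => by simp [h.2 p hp]⟩

lemma HS.sq {K : Set (Spc d)} {u : ℝ × Spc d → ℝ} (h : HS K u) :
    HS K (fun p => u p ^ 2) :=
  ⟨h.1.pow 2, fun p hp => by simp [h.2 p hp]⟩

lemma HS.smul {K : Set (Spc d)} {u : ℝ × Spc d → ℝ} (h : HS K u) (a : ℝ) :
    HS K (fun p => a * u p) :=
  ⟨contDiff_const.mul h.1, fun p hp => by simp [h.2 p hp]⟩

lemma HS.L {K : Set (Spc d)} (hK : IsClosed K) {u : ℝ × Spc d → ℝ} (h : HS K u) :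
    HS K (LL u) := by
  refine ⟨?_, ?_⟩
  · unfold LL
    exact ContDiff.sum fun i _ => ((h.D hK _).D hK _).1
  · intro p hp
    exact Finset.sum_eq_zero fun i _ => ((h.D hK _).D hK _).2 p hp

lemma Dd_comm {u : ℝ × Spc d → ℝ} (h : ContDiff ℝ (⊤ : ℕ∞) u) (e e' : ℝ × Spc d) :
    Dd e (Dd e' u) = Dd e' (Dd e u) := by
  funext p
  have hd : DifferentiableAt ℝ (fderiv ℝ u) p := by
    have : ContDiff ℝ (⊤ : ℕ∞) (fderiv ℝ u) := h.fderiv_right (by simp)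
    exact (this.differentiable (by simp)) p
  have key : ∀ a b, Dd a (Dd b u) p = fderiv ℝ (fderiv ℝ u) p a b := by
    intro a b
    have : Dd b u = fun q => fderiv ℝ u q b := rfl
    rw [Dd, this, fderiv_clm_apply hd (differentiableAt_const _)]
    simp
  rw [key, key]
  have hs : IsSymmSndFDerivAt ℝ u p := by
    apply ContDiffAt.isSymmSndFDerivAt (n := (⊤ : ℕ∞)) h.contDiffAt
    simp only [minSmoothness_of_isRCLikeNormedField]
    exact WithTop.coe_le_coe.2 (le_top : (2 : ℕ∞) ≤ ⊤)
  exact hs.eq e e'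

lemma Dd_LL {K : Set (Spc d)} (hK : IsClosed K) {u : ℝ × Spc d → ℝ} (h : HS K u)
    (e : ℝ × Spc d) : Dd e (LL u) = LL (Dd e u) := by
  funext p
  have h1 : LL u = fun q => ∑ i, Dd (0, EuclideanSpace.single i 1)
    (Dd (0, EuclideanSpace.single i 1) u) q := rfl
  rw [Dd, h1, fderiv_fun_sum (fun i _ => ((h.D hK _).D hK _).diff p)]
  rw [sum_apply, LL]
  refine Finset.sum_congr rfl fun i _ => ?_
  change Dd e (Dd _ (Dd _ u)) p = _
  rw [Dd_comm (h.D hK _).1, Dd_comm h.1 e]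

/-- Slice derivative in time. -/
lemma slice_t {u : ℝ × Spc d → ℝ} (h : Differentiable ℝ u) (t : ℝ) (x : Spc d) :
    HasDerivAt (fun s => u (s, x)) (Dd (1, 0) u (t, x)) t := by
  have h1 : HasDerivAt (fun s : ℝ => (s, x)) ((1 : ℝ), (0 : Spc d)) t :=
    (hasDerivAt_id t).prodMk (hasDerivAt_const t x)
  exact (h (t, x)).hasFDerivAt.comp_hasDerivAt t h1

lemma slice_x {u : ℝ × Spc d → ℝ} (h : Differentiable ℝ u) (t : ℝ) (x e : Spc d) :
    fderiv ℝ (fun y => u (t, y)) x e = Dd (0, e) u (t, x) := by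
  have h1 : HasFDerivAt (fun y : Spc d => (t, y)) (ContinuousLinearMap.inr ℝ ℝ (Spc d)) x :=
    hasFDerivAt_prodMk_right t x
  have := (h (t, x)).hasFDerivAt.comp x h1
  have h2 : fderiv ℝ (fun y => u (t, y)) x = _ := this.fderiv
  rw [h2]
  simp [Dd]

lemma slice_diff {u : ℝ × Spc d → ℝ} (h : Differentiable ℝ u) (t : ℝ) :
    Differentiable ℝ (fun y => u (t, y)) :=
  h.comp ((differentiable_const t).prodMk differentiable_id)

lemma lap_slice {K : Set (Spc d)} (hK : IsClosed K) {u : ℝ × Spc d → ℝ} (h : HS K u) (t : ℝ)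
    (x : Spc d) : lap (fun y => u (t, y)) x = LL u (t, x) := by
  unfold lap LL
  refine Finset.sum_congr rfl fun i _ => ?_
  simp_rw [slice_x h.diff]
  exact slice_x (h.D hK _).diff t x _

lemma HS.integrable_slice {K : Set (Spc d)} (hK : IsCompact K) {u : ℝ × Spc d → ℝ}
    (h : HS K u) (t : ℝ) : Integrable (fun x => u (t, x)) := by
  apply Continuous.integrable_of_hasCompactSupport
  · exact h.1.continuous.comp (by fun_prop)
  · exact HasCompactSupport.intro hK fun x hx => h.2 (t, x) hx

lemma HS.integral_eq {K Ω : Set (Spc d)} (hKΩ : K ⊆ Ω) {u : ℝ × Spc d → ℝ}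
    (h : HS K u) (t : ℝ) : ∫ x in Ω, u (t, x) = ∫ x, u (t, x) :=
  setIntegral_eq_integral_of_forall_compl_eq_zero fun x hx => h.2 (t, x) fun hk => hx (hKΩ hk)

/-- Spatial integral of a spacetime function. -/
def ig (u : ℝ × Spc d → ℝ) (t : ℝ) : ℝ := ∫ x, u (t, x)

lemma ig_deriv {K : Set (Spc d)} (hK : IsCompact K) {u : ℝ × Spc d → ℝ}
    (h : HS K u) (t : ℝ) : HasDerivAt (ig u) (ig (Dd (1, 0) u) t) t := by
  have hD := h.D hK.isClosed (1, 0)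
  obtain ⟨C, hC⟩ := ((isCompact_Icc (a := t - 1) (b := t + 1)).prod hK).exists_bound_of_continuousOn
    hD.1.continuous.continuousOn
  have hs : Set.Icc (t - 1) (t + 1) ∈ nhds t := Icc_mem_nhds (by linarith) (by linarith)
  refine (hasDerivAt_integral_of_dominated_loc_of_deriv_le (μ := volume)
    (F := fun s x => u (s, x)) (F' := fun s x => Dd (1, 0) u (s, x))
    (bound := K.indicator fun _ => C) hs ?_ ?_ ?_ ?_ ?_ ?_).2
  · exact Filter.Eventually.of_forall fun s => (h.integrable_slice hK s).1
  · exact h.integrable_slice hK t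
  · exact (hD.integrable_slice hK t).1
  · refine Filter.Eventually.of_forall fun x s hs => ?_
    by_cases hx : x ∈ K
    · rw [Set.indicator_of_mem hx]
      exact hC (s, x) ⟨hs, hx⟩
    · rw [Set.indicator_of_notMem hx, hD.2 (s, x) hx]; simp
  · rw [integrable_indicator_iff hK.measurableSet]
    exact integrableOn_const hK.measure_lt_top.ne
  · exact Filter.Eventually.of_forall fun x s _ => slice_t h.diff s x

lemma ig_cont {K : Set (Spc d)} (hK : IsCompact K) {u : ℝ × Spc d → ℝ}
    (h : HS K u) : Continuous (ig u) :=
  continuous_iff_continuousAt.2 fun t => (ig_deriv hK h t).continuousAt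

lemma ig_ibp {K : Set (Spc d)} (hK : IsCompact K) {u w : ℝ × Spc d → ℝ}
    (hu : HS K u) (hw : HS K w) (e : Spc d) (t : ℝ) :
    ig (fun p => u p * Dd (0, e) w p) t = - ig (fun p => Dd (0, e) u p * w p) t := by
  have hc := hK.isClosed
  have := integral_mul_fderiv_eq_neg_fderiv_mul_of_integrable (μ := volume) (v := e)
    (f := fun x => u (t, x)) (g := fun x => w (t, x))
    (by simp_rw [slice_x hu.diff]; exact ((hu.D hc _).mul hw).integrable_slice hK t)
    (by simp_rw [slice_x hw.diff]; exact (hu.mul (hw.D hc _)).integrable_slice hK t)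
    ((hu.mul hw).integrable_slice hK t)
    (fun x _ => slice_diff hu.diff t x) (fun x _ => slice_diff hw.diff t x)
  simp_rw [slice_x hu.diff, slice_x hw.diff] at this
  exact this

lemma ig_LL {K : Set (Spc d)} (hK : IsCompact K) {u w : ℝ × Spc d → ℝ}
    (hu : HS K u) (hw : HS K w) (t : ℝ) :
    ig (fun p => u p * LL w p) t = - ∑ i, ig (fun p => Dd (0, EuclideanSpace.single i 1) u p *
      Dd (0, EuclideanSpace.single i 1) w p) t := by
  have hc := hK.isClosed
  rw [← Finset.sum_neg_distrib]
  simp_rw [← ig_ibp hK hu (hw.D hc _)]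
  unfold ig LL
  simp_rw [Finset.mul_sum]
  exact integral_finsetSum _ fun i _ =>
    (hu.mul ((hw.D hc _).D hc _)).integrable_slice hK t

lemma ig_LL_symm {K : Set (Spc d)} (hK : IsCompact K) {u w : ℝ × Spc d → ℝ}
    (hu : HS K u) (hw : HS K w) (t : ℝ) :
    ig (fun p => u p * LL w p) t = ig (fun p => w p * LL u p) t := by
  rw [ig_LL hK hu hw, ig_LL hK hw hu]
  simp_rw [mul_comm]

lemma grad_sq (g : Spc d → ℝ) (x : Spc d) :
    ‖gradient g x‖ ^ 2 = ∑ i, (fderiv ℝ g x (EuclideanSpace.single i 1)) ^ 2 := by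
  rw [EuclideanSpace.norm_sq_eq]
  refine Finset.sum_congr rfl fun i _ => ?_
  have : fderiv ℝ g x (EuclideanSpace.single i 1) = gradient g x i := by
    rw [← InnerProductSpace.toDual_symm_apply (𝕜 := ℝ)]
    change inner ℝ (gradient g x) _ = _
    rw [EuclideanSpace.inner_single_right]
    simp
  rw [this, Real.norm_eq_abs, sq_abs]

lemma sqGrad_slice {K Ω : Set (Spc d)} (hK : IsCompact K) (hKΩ : K ⊆ Ω) {u : ℝ × Spc d → ℝ}
    (hu : HS K u) (t : ℝ) :
    sqGrad Ω (fun x => u (t, x)) = - ig (fun p => u p * LL u p) t := by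
  have hc := hK.isClosed
  rw [ig_LL hK hu hu, neg_neg]
  unfold sqGrad
  simp_rw [grad_sq, slice_x hu.diff]
  have h2 : ∀ i : Fin d, HS K (fun p => Dd (0, EuclideanSpace.single i 1) u p *
      Dd (0, EuclideanSpace.single i 1) u p) := fun i => (hu.D hc _).mul (hu.D hc _)
  unfold ig
  simp_rw [← (h2 _).integral_eq hKΩ, sq]
  exact integral_finsetSum _ fun i _ => ((h2 i).integrable_slice hK t).integrableOn

lemma sqL2_slice {K Ω : Set (Spc d)} (hKΩ : K ⊆ Ω) {u : ℝ × Spc d → ℝ}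
    (hu : HS K u) (t : ℝ) :
    sqL2 Ω (fun x => u (t, x)) = ig (fun p => u p ^ 2) t :=
  hu.sq.integral_eq hKΩ t

lemma lap_le_hess {K Ω : Set (Spc d)} (hK : IsCompact K) (hKΩ : K ⊆ Ω) {u : ℝ × Spc d → ℝ}
    (hu : HS K u) (t : ℝ) :
    ig (fun p => LL u p ^ 2) t ≤ (d : ℝ) ^ 2 * sqHess Ω (fun x => u (t, x)) := by
  have hc := hK.isClosed
  rw [← sqL2_slice hKΩ (hu.L hc)]
  unfold sqL2 sqHess
  rw [← integral_const_mul]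
  have hg : ContDiff ℝ (⊤ : ℕ∞) (fun x => u (t, x)) :=
    hu.1.comp (contDiff_const.prodMk contDiff_id)
  have hz : HasCompactSupport (fun x => u (t, x)) :=
    HasCompactSupport.intro hK fun x hx => hu.2 (t, x) hx
  have hcont : Continuous (iteratedFDeriv ℝ 2 (fun x => u (t, x))) :=
    hg.continuous_iteratedFDeriv (by norm_cast)
  refine integral_mono ((hu.L hc).sq.integrable_slice hK t).integrableOn ?_ ?_
  · refine Integrable.integrableOn (Continuous.integrable_of_hasCompactSupport (by fun_prop) ?_)
    have := hz.iteratedFDeriv (𝕜 := ℝ) 2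
    exact this.comp_left (g := fun A => (d : ℝ) ^ 2 * ‖A‖ ^ 2) (by simp)
  · intro x
    have h1 : |LL u (t, x)| ≤ d * ‖iteratedFDeriv ℝ 2 (fun x => u (t, x)) x‖ := by
      rw [← lap_slice hc hu]
      unfold lap
      refine (Finset.abs_sum_le_sum_abs _ _).trans ?_
      have : ∀ i ∈ (Finset.univ : Finset (Fin d)),
        |fderiv ℝ (fun y => fderiv ℝ (fun y => u (t, y)) y (EuclideanSpace.single i 1)) x
          (EuclideanSpace.single i 1)| ≤ ‖iteratedFDeriv ℝ 2 (fun x => u (t, x)) x‖ := by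
        intro i _
        have h3 : DifferentiableAt ℝ (fderiv ℝ (fun y => u (t, y))) x := by
          have : ContDiff ℝ (⊤ : ℕ∞) (fderiv ℝ (fun y => u (t, y))) := hg.fderiv_right (by simp)
          exact (this.differentiable (by simp)) x
        have h4 := (iteratedFDeriv ℝ 2 (fun x => u (t, x)) x).le_opNorm
          (fun _ => EuclideanSpace.single i 1)
        rw [iteratedFDeriv_two_apply] at h4
        rw [fderiv_clm_apply h3 (differentiableAt_const _)]
        simpa using h4
      refine (Finset.sum_le_sum this).trans ?_
      simp
    have := pow_le_pow_left₀ (abs_nonneg _) h1 2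
    rw [sq_abs, mul_pow] at this
    exact this

lemma gron (E E' P Q : ℝ → ℝ) (M b T : ℝ) (hM : 0 ≤ M) (hb : 0 < b) (hT : 0 < T)
    (hE : ∀ t, HasDerivAt E (E' t) t) (hP : Continuous P) (hQ : Continuous Q)
    (hE0 : ∀ t, 0 ≤ E t) (hP0 : ∀ t, 0 ≤ P t) (hQ0 : ∀ t, 0 ≤ Q t)
    (h : ∀ t, E' t ≤ M * E t + M * Q t - b * P t) :
    (∀ t ∈ Set.Icc 0 T, E t ≤ exp (M * T) * (E 0 + M * ∫ s in (0:ℝ)..T, Q s)) ∧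
    b * (∫ s in (0:ℝ)..T, P s) ≤ exp (M * T) * (E 0 + M * ∫ s in (0:ℝ)..T, Q s) := by
  set Φ : ℝ → ℝ := fun t => exp (-M * t) * E t + b * exp (-M * T) * (∫ s in (0:ℝ)..t, P s)
    - M * ∫ s in (0:ℝ)..t, Q s with hΦ
  have hd : ∀ t, HasDerivAt Φ ((exp (-M * t) * -M) * E t + exp (-M * t) * E' t
      + b * exp (-M * T) * P t - M * Q t) t := by
    intro t
    have h1 : HasDerivAt (fun t => exp (-M * t)) (exp (-M * t) * -M) t := by
      simpa using ((hasDerivAt_id t).const_mul (-M)).exp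
    have h2 := intervalIntegral.integral_hasDerivAt_right (hP.intervalIntegrable 0 t)
      (hP.stronglyMeasurableAtFilter _ _) hP.continuousAt
    have h3 := intervalIntegral.integral_hasDerivAt_right (hQ.intervalIntegrable 0 t)
      (hQ.stronglyMeasurableAtFilter _ _) hQ.continuousAt
    exact ((h1.mul (hE t)).add (h2.const_mul _)).sub (h3.const_mul M)
  have hanti : AntitoneOn Φ (Set.Icc 0 T) := by
    refine antitoneOn_of_deriv_nonpos (convex_Icc 0 T)
      (fun t _ => (hd t).continuousAt.continuousWithinAt)
      (fun t _ => (hd t).differentiableAt.differentiableWithinAt) ?_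
    intro t ht
    rw [interior_Icc] at ht
    rw [(hd t).deriv]
    have e1 : exp (-M * t) ≤ 1 := by
      rw [exp_le_one_iff]; nlinarith [ht.1]
    have e2 : exp (-M * T) ≤ exp (-M * t) := by
      rw [exp_le_exp]; nlinarith [ht.2]
    have a1 := mul_le_mul_of_nonneg_left (h t) (exp_pos (-M * t)).le
    have a2 := mul_le_mul_of_nonneg_right e1 (mul_nonneg hM (hQ0 t))
    have a3 := mul_le_mul_of_nonneg_right e2 (mul_nonneg hb.le (hP0 t))
    nlinarith
  have key : ∀ t ∈ Set.Icc 0 T, exp (-M * t) * E t + b * exp (-M * T) * (∫ s in (0:ℝ)..t, P s)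
      ≤ E 0 + M * ∫ s in (0:ℝ)..T, Q s := by
    intro t ht
    have := hanti (Set.left_mem_Icc.2 hT.le) ht ht.1
    simp only [hΦ] at this
    simp at this
    have hm : ∫ s in (0:ℝ)..t, Q s ≤ ∫ s in (0:ℝ)..T, Q s :=
      intervalIntegral.integral_mono_interval le_rfl ht.1 ht.2
        (Filter.Eventually.of_forall hQ0) (hQ.intervalIntegrable _ _)
    have := mul_le_mul_of_nonneg_left hm hM
    simp only [neg_mul]
    linarith
  have hexp : exp (M * T) * exp (-M * T) = 1 := by rw [← exp_add]; simp
  refine ⟨fun t ht => ?_, ?_⟩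
  · have h1 := key t ht
    have h2 : 0 ≤ ∫ s in (0:ℝ)..t, P s := intervalIntegral.integral_nonneg ht.1 fun s _ => hP0 s
    have h3 : 0 ≤ b * exp (-M * T) * (∫ s in (0:ℝ)..t, P s) := by positivity
    have e2 : exp (-M * T) ≤ exp (-M * t) := by
      rw [exp_le_exp]; nlinarith [ht.2]
    have h4 := mul_le_mul_of_nonneg_right e2 (hE0 t)
    have h5 : exp (-M * T) * E t ≤ E 0 + M * ∫ s in (0:ℝ)..T, Q s := by linarith
    have h6 := mul_le_mul_of_nonneg_left h5 (exp_pos (M * T)).le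
    rwa [← mul_assoc, hexp, one_mul] at h6
  · have h1 := key T (Set.right_mem_Icc.2 hT.le)
    have h3 : 0 ≤ exp (-M * T) * E T := mul_nonneg (exp_pos _).le (hE0 T)
    have h5 : exp (-M * T) * (b * ∫ s in (0:ℝ)..T, P s) ≤ E 0 + M * ∫ s in (0:ℝ)..T, Q s := by
      linarith
    have h6 := mul_le_mul_of_nonneg_left h5 (exp_pos (M * T)).le
    rwa [← mul_assoc, hexp, one_mul] at h6

lemma ig_add {K : Set (Spc d)} (hK : IsCompact K) {u w : ℝ × Spc d → ℝ}
    (hu : HS K u) (hw : HS K w) (t : ℝ) :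
    ig (fun p => u p + w p) t = ig u t + ig w t :=
  integral_add (hu.integrable_slice hK t) (hw.integrable_slice hK t)

lemma ig_sub {K : Set (Spc d)} (hK : IsCompact K) {u w : ℝ × Spc d → ℝ}
    (hu : HS K u) (hw : HS K w) (t : ℝ) :
    ig (fun p => u p - w p) t = ig u t - ig w t :=
  integral_sub (hu.integrable_slice hK t) (hw.integrable_slice hK t)

lemma ig_smul (a : ℝ) (u : ℝ × Spc d → ℝ) (t : ℝ) :
    ig (fun p => a * u p) t = a * ig u t :=
  integral_const_mul _ _

lemma ig_mono {K : Set (Spc d)} (hK : IsCompact K) {u w : ℝ × Spc d → ℝ}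
    (hu : HS K u) (hw : HS K w) (t : ℝ) (h : ∀ p, u p ≤ w p) : ig u t ≤ ig w t :=
  integral_mono (hu.integrable_slice hK t) (hw.integrable_slice hK t) fun x => h (t, x)

lemma ig_nonneg {u : ℝ × Spc d → ℝ} (t : ℝ) (h : ∀ p, 0 ≤ u p) : 0 ≤ ig u t :=
  integral_nonneg fun x => h (t, x)

lemma ig_grad_nonneg {K : Set (Spc d)} (hK : IsCompact K) {u : ℝ × Spc d → ℝ}
    (hu : HS K u) (t : ℝ) : 0 ≤ - ig (fun p => u p * LL u p) t := by
  rw [← sqGrad_slice hK subset_rfl hu]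
  exact integral_nonneg fun x => by positivity

lemma pt_ineq (b c : ℝ) (hb : 0 < b) (u v Lu Lv vt : ℝ) :
    2 * c ^ 2 * (Lu * Lv) + 2 * (v * vt) + 2 * (u * v) - 2 * (vt * Lv) ≤
      (2 * b + c ^ 2 + 2 + 2 / b) * (c ^ 2 * Lu ^ 2 + v ^ 2 + u ^ 2)
      + (2 * b + c ^ 2 + 2 + 2 / b) * (vt - b * Lv - c ^ 2 * Lu) ^ 2 - b * Lv ^ 2 := by
  obtain ⟨f, hf⟩ : ∃ f, f = vt - b * Lv - c ^ 2 * Lu := ⟨_, rfl⟩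
  have hvt : vt = b * Lv + c ^ 2 * Lu + f := by rw [hf]; ring
  rw [← hf, hvt]
  have h1 : -2 * f * Lv ≤ b / 2 * Lv ^ 2 + 2 / b * f ^ 2 := by
    have : b / 2 * Lv ^ 2 + 2 / b * f ^ 2 + 2 * f * Lv = b / 2 * (Lv + 2 / b * f) ^ 2 := by
      field_simp; ring
    have : 0 ≤ b / 2 * (Lv + 2 / b * f) ^ 2 := by positivity
    linarith
  have h2 : 2 * b * v * Lv ≤ b / 2 * Lv ^ 2 + 2 * b * v ^ 2 := by
    have : 0 ≤ b / 2 * (Lv - 2 * v) ^ 2 := by positivity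
    nlinarith
  have h3 : 2 * c ^ 2 * v * Lu ≤ c ^ 2 * v ^ 2 + c ^ 2 * Lu ^ 2 := by
    have : 0 ≤ c ^ 2 * (v - Lu) ^ 2 := by positivity
    nlinarith
  have h4 : 2 * v * f ≤ v ^ 2 + f ^ 2 := by nlinarith [sq_nonneg (v - f)]
  have h5 : 2 * u * v ≤ v ^ 2 + u ^ 2 := by nlinarith [sq_nonneg (v - u)]
  have q : 0 < 2 / b := by positivity
  have p1 : 0 ≤ 2 / b * (c ^ 2 * Lu ^ 2 + v ^ 2 + u ^ 2) := by positivity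
  have p2 : 0 ≤ (2 * b + c ^ 2 + 1) * (c ^ 2 * Lu ^ 2) := by positivity
  have p3 : 0 ≤ (2 * b + c ^ 2 + 1) * u ^ 2 := by positivity
  have p4 : 0 ≤ (2 * b + c ^ 2 + 1) * f ^ 2 := by positivity
  linarith

/-- The energy density. -/
def eD (c : ℝ) (u v : ℝ × Spc d → ℝ) (p : ℝ × Spc d) : ℝ :=
  (c ^ 2 * LL u p ^ 2 + v p ^ 2 + u p ^ 2) - v p * LL v p

lemma energy_ineq {K : Set (Spc d)} (hK : IsCompact K) (b c : ℝ) (hb : 0 < b)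
    {u v vt : ℝ × Spc d → ℝ} (hu : HS K u) (hv : v = Dd (1, 0) u) (hvt : vt = Dd (1, 0) v)
    (t : ℝ) :
    HasDerivAt (ig (eD c u v)) (ig (Dd (1, 0) (eD c u v)) t) t ∧
    ig (Dd (1, 0) (eD c u v)) t ≤ (2 * b + c ^ 2 + 2 + 2 / b) * ig (eD c u v) t
      + (2 * b + c ^ 2 + 2 + 2 / b) * ig (fun p => (vt p - b * LL v p - c ^ 2 * LL u p) ^ 2) t
      - b * ig (fun p => LL v p ^ 2) t := by
  have hc := hK.isClosed
  have Hv : HS K v := hv ▸ hu.D hc _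
  have Hvt : HS K vt := hvt ▸ Hv.D hc _
  have HLu := hu.L hc
  have HLv := Hv.L hc
  have HLvt := Hvt.L hc
  have H0 : HS K (fun p => c ^ 2 * LL u p ^ 2 + v p ^ 2 + u p ^ 2) :=
    ((HLu.sq.smul _).add Hv.sq).add hu.sq
  have He : HS K (eD c u v) := H0.sub (Hv.mul HLv)
  refine ⟨ig_deriv hK He t, ?_⟩
  set M := 2 * b + c ^ 2 + 2 + 2 / b with hM
  have hMpos : 0 < M := by positivity
  have Hg : HS K (fun p => vt p - b * LL v p - c ^ 2 * LL u p) :=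
    (Hvt.sub (HLv.smul b)).sub (HLu.smul _)
  have hDe : Dd (1, 0) (eD c u v) = fun p => (2 * c ^ 2 * (LL u p * LL v p) + 2 * (v p * vt p)
      + 2 * (u p * v p) - vt p * LL v p) - v p * LL vt p := by
    funext ⟨s, x⟩
    have d1 := slice_t He.diff s x
    have a1 := slice_t HLu.diff s x
    have a2 := slice_t HLv.diff s x
    have a3 := slice_t hu.diff s x
    have a4 := slice_t Hv.diff s x
    rw [Dd_LL hc hu, ← hv] at a1
    rw [Dd_LL hc Hv, ← hvt] at a2
    rw [← hv] at a3
    rw [← hvt] at a4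
    have d2 := ((((a1.pow 2).const_mul (c ^ 2)).add (a4.pow 2)).add (a3.pow 2)).sub (a4.mul a2)
    have := d1.unique d2
    rw [this]
    simp
    ring
  have HA : HS K (fun p => 2 * c ^ 2 * (LL u p * LL v p) + 2 * (v p * vt p)
      + 2 * (u p * v p)) :=
    (((HLu.mul HLv).smul _).add ((Hv.mul Hvt).smul 2)).add ((hu.mul Hv).smul 2)
  rw [hDe, ig_sub hK (HA.sub (Hvt.mul HLv)) (Hv.mul HLvt), ig_sub hK HA (Hvt.mul HLv),
    ig_LL_symm hK Hv Hvt]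
  have hm := ig_mono hK (HA.sub ((Hvt.mul HLv).smul 2))
    (((H0.smul M).add (Hg.sq.smul M)).sub (HLv.sq.smul b)) t
    (fun p => pt_ineq b c hb (u p) (v p) (LL u p) (LL v p) (vt p))
  rw [ig_sub hK HA ((Hvt.mul HLv).smul 2), ig_smul,
    ig_sub hK ((H0.smul M).add (Hg.sq.smul M)) (HLv.sq.smul b),
    ig_add hK (H0.smul M) (Hg.sq.smul M), ig_smul, ig_smul, ig_smul] at hm
  have hE : ig (eD c u v) t = _ := ig_sub hK H0 (Hv.mul HLv) t
  rw [hE]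
  have := mul_nonneg hMpos.le (ig_grad_nonneg hK Hv t)
  linarith

/-- higher-order estimate for the nonlocal heat equation. -/
theorem heat_H2_estimate (d : ℕ) (hd : d = 1 ∨ d = 2 ∨ d = 3)
    (Ω : Set (Spc d)) (hne : Ω.Nonempty) (hop : IsOpen Ω) (hbd : Bornology.IsBounded Ω)
    (b c : ℝ) (hb : 0 < b) (hc : 0 < c) (T : ℝ) (hT : 0 < T) :
    ∃ C > (0:ℝ),
      ∀ ψ f : ℝ → Spc d → ℝ, Admissible Ω ψ →
        Continuous (fun p : ℝ × Spc d => f p.1 p.2) →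
        (∀ t ∈ Set.Icc (0:ℝ) T, IsHeat Ω b c ψ f t) →
        supIcc T (fun t => sqH1 Ω (ψ t) + sqL2 Ω (lap (ψ t)))
          + (∫ t in (0:ℝ)..T, (sqH1 Ω (tderiv ψ t) + sqL2 Ω (lap (tderiv ψ t))))
        ≤ C * (sqH2 Ω (ψ 0) + sqH1 Ω (tderiv ψ 0) + ∫ t in (0:ℝ)..T, sqL2 Ω (f t)) := by
  refine ⟨(3 / 2 * (1 + 1 / c ^ 2) + T + 1 / b) * (exp ((2 * b + c ^ 2 + 2 + 2 / b) * T) *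
    (1 + d ^ 2 * c ^ 2 + (2 * b + c ^ 2 + 2 + 2 / b))), by positivity, ?_⟩
  intro ψ f hψ _ hheat
  obtain ⟨hsm, K, hK, hKΩ, hsupp⟩ := hψ
  have hcl := hK.isClosed
  set M := 2 * b + c ^ 2 + 2 + 2 / b with hM
  have hMpos : 0 < M := by positivity
  obtain ⟨u, hu⟩ : ∃ u : ℝ × Spc d → ℝ, u = fun p => ψ p.1 p.2 := ⟨_, rfl⟩
  have Hu : HS K u := by
    subst hu
    refine ⟨hsm, fun p hp => ?_⟩
    by_contra hne
    exact hp (hsupp p.1 hne)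
  obtain ⟨v, hv⟩ : ∃ v, v = Dd (1, 0) u := ⟨_, rfl⟩
  obtain ⟨vt, hvt⟩ : ∃ vt, vt = Dd (1, 0) v := ⟨_, rfl⟩
  have Hv : HS K v := hv ▸ Hu.D hcl _
  have Hvt : HS K vt := hvt ▸ Hv.D hcl _
  have e0 : ∀ t, ψ t = fun x => u (t, x) := fun t => by rw [hu]
  have e1 : ∀ t, tderiv ψ t = fun x => v (t, x) := by
    intro t
    funext x
    rw [hv, ← (slice_t Hu.diff t x).deriv, hu]
    rfl
  have e2 : ∀ t, tderiv (tderiv ψ) t = fun x => vt (t, x) := by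
    intro t
    funext x
    rw [hvt, ← (slice_t Hv.diff t x).deriv]
    simp only [tderiv.eq_1 (tderiv ψ), e1]
  have e3 : ∀ t, lap (ψ t) = fun x => LL u (t, x) := fun t => by
    funext x
    rw [e0, lap_slice hcl Hu]
  have e4 : ∀ t, lap (tderiv ψ t) = fun x => LL v (t, x) := fun t => by
    funext x
    rw [e1, lap_slice hcl Hv]
  have HLu := Hu.L hcl
  have HLv := Hv.L hcl
  have Hg : HS K (fun p => vt p - b * LL v p - c ^ 2 * LL u p) :=
    (Hvt.sub (HLv.smul b)).sub (HLu.smul _)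
  have hf : ∀ t ∈ Set.Icc 0 T,
      sqL2 Ω (f t) = ig (fun p => (vt p - b * LL v p - c ^ 2 * LL u p) ^ 2) t := by
    intro t ht
    rw [← sqL2_slice hKΩ Hg]
    refine setIntegral_congr_fun hop.measurableSet fun x hx => ?_
    have := hheat t ht x hx
    rw [e2, e3, e4] at this
    simp only [← this]
  have hfint : ∫ t in (0:ℝ)..T, sqL2 Ω (f t) =
      ∫ t in (0:ℝ)..T, ig (fun p => (vt p - b * LL v p - c ^ 2 * LL u p) ^ 2) t := by
    refine intervalIntegral.integral_congr fun t ht => ?_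
    rw [Set.uIcc_of_le hT.le] at ht
    exact hf t ht
  have H0 : HS K (fun p => c ^ 2 * LL u p ^ 2 + v p ^ 2 + u p ^ 2) :=
    ((HLu.sq.smul _).add Hv.sq).add Hu.sq
  have hEeq : ∀ t, ig (eD c u v) t = c ^ 2 * ig (fun p => LL u p ^ 2) t
      + ig (fun p => v p ^ 2) t + ig (fun p => u p ^ 2) t + - ig (fun p => v p * LL v p) t := by
    intro t
    have h1 : ig (eD c u v) t = _ := ig_sub hK H0 (Hv.mul HLv) t
    rw [h1, ig_add hK ((HLu.sq.smul _).add Hv.sq) Hu.sq, ig_add hK (HLu.sq.smul _) Hv.sq, ig_smul]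
    ring
  have nLu : ∀ t, 0 ≤ ig (fun p => LL u p ^ 2) t := fun t => ig_nonneg t fun p => sq_nonneg _
  have nLv : ∀ t, 0 ≤ ig (fun p => LL v p ^ 2) t := fun t => ig_nonneg t fun p => sq_nonneg _
  have nu : ∀ t, 0 ≤ ig (fun p => u p ^ 2) t := fun t => ig_nonneg t fun p => sq_nonneg _
  have nv : ∀ t, 0 ≤ ig (fun p => v p ^ 2) t := fun t => ig_nonneg t fun p => sq_nonneg _
  have nG : ∀ t, 0 ≤ - ig (fun p => v p * LL v p) t := fun t => ig_grad_nonneg hK Hv t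
  have nGu : ∀ t, 0 ≤ - ig (fun p => u p * LL u p) t := fun t => ig_grad_nonneg hK Hu t
  have nE : ∀ t, 0 ≤ ig (eD c u v) t := by
    intro t
    rw [hEeq]
    have := nLu t; have := nv t; have := nu t; have := nG t
    positivity
  obtain ⟨g1, g2⟩ := gron (ig (eD c u v)) (ig (Dd (1, 0) (eD c u v))) (ig (fun p => LL v p ^ 2))
    (ig (fun p => (vt p - b * LL v p - c ^ 2 * LL u p) ^ 2)) M b T hMpos.le hb hT
    (fun t => (energy_ineq hK b c hb Hu hv hvt t).1) (ig_cont hK HLv.sq) (ig_cont hK Hg.sq)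
    nE nLv (fun t => ig_nonneg t fun p => sq_nonneg _)
    (fun t => (energy_ineq hK b c hb Hu hv hvt t).2)
  rw [← hfint] at g1 g2
  obtain ⟨F, hF⟩ : ∃ F, F = ∫ t in (0:ℝ)..T, sqL2 Ω (f t) := ⟨_, rfl⟩
  rw [← hF] at g1 g2 ⊢
  have hF0 : 0 ≤ F := by
    rw [hF]
    exact intervalIntegral.integral_nonneg hT.le fun t _ => integral_nonneg fun x => sq_nonneg _
  -- bound of the energy at time zero by the data
  obtain ⟨D0, hD0⟩ : ∃ D0, D0 = sqH2 Ω (ψ 0) + sqH1 Ω (tderiv ψ 0) := ⟨_, rfl⟩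
  rw [← hD0]
  have hE0 : ig (eD c u v) 0 ≤ (1 + d ^ 2 * c ^ 2) * D0 ∧ 0 ≤ D0 := by
    have hl := lap_le_hess hK hKΩ Hu 0
    have hh : 0 ≤ sqHess Ω (fun x => u (0, x)) := integral_nonneg fun x => by positivity
    rw [hD0, hEeq, sqH2, sqH1, e0, e1, sqL2_slice hKΩ Hu, sqL2_slice hKΩ Hv,
      sqGrad_slice hK hKΩ Hu, sqGrad_slice hK hKΩ Hv]
    have n1 := nv 0
    have n2 := nu 0
    have n3 := nG 0
    have n4 := nGu 0
    generalize ig (fun p => v p ^ 2) 0 = a1 at *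
    generalize ig (fun p => u p ^ 2) 0 = a2 at *
    generalize -ig (fun p => v p * LL v p) 0 = a3 at *
    generalize -ig (fun p => u p * LL u p) 0 = a4 at *
    generalize sqHess Ω (fun x => u (0, x)) = a5 at *
    refine ⟨?_, by positivity⟩
    have m1 := mul_le_mul_of_nonneg_left hl (sq_nonneg c)
    have m2 : 0 ≤ (d : ℝ) ^ 2 * c ^ 2 * (a1 + a2 + a3 + a4) := by positivity
    nlinarith
  obtain ⟨hE0, hD0n⟩ := hE0
  obtain ⟨R, hR⟩ : ∃ R, R = exp (M * T) * (ig (eD c u v) 0 + M * F) := ⟨_, rfl⟩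
  rw [← hR] at g1 g2
  have hRle : R ≤ exp (M * T) * (1 + d ^ 2 * c ^ 2 + M) * (D0 + F) := by
    rw [hR, mul_assoc]
    refine mul_le_mul_of_nonneg_left ?_ (exp_pos _).le
    have m1 : 0 ≤ (1 + (d : ℝ) ^ 2 * c ^ 2) * F := by positivity
    have m2 : 0 ≤ M * D0 := by positivity
    nlinarith
  have hsup : supIcc T (fun t => sqH1 Ω (ψ t) + sqL2 Ω (lap (ψ t))) ≤
      3 / 2 * (1 + 1 / c ^ 2) * R := by
    haveI : Nonempty (Set.Icc (0:ℝ) T) := ⟨⟨0, Set.left_mem_Icc.2 hT.le⟩⟩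
    refine ciSup_le fun ⟨t, ht⟩ => ?_
    have hEt := g1 t ht
    simp only []
    rw [e3, sqH1, e0, sqL2_slice hKΩ Hu, sqL2_slice hKΩ HLu, sqGrad_slice hK hKΩ Hu]
    have hy : - ig (fun p => u p * LL u p) t ≤
        1 / 2 * (ig (fun p => u p ^ 2) t + ig (fun p => LL u p ^ 2) t) := by
      rw [← ig_add hK Hu.sq HLu.sq, ← ig_smul]
      have := ig_mono hK ((Hu.mul HLu).smul (-1)) ((Hu.sq.add HLu.sq).smul (1 / 2)) t
        (fun p => by nlinarith [sq_nonneg (u p + LL u p)])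
      rw [ig_smul] at this
      linarith
    rw [hEeq] at hEt
    have n0 := nLu t
    have n1 := nv t
    have n2 := nu t
    have n3 := nG t
    have k1 : ig (fun p => u p ^ 2) t ≤ R := by
      have := mul_nonneg (sq_nonneg c) n0
      linarith
    have k2 : ig (fun p => LL u p ^ 2) t ≤ 1 / c ^ 2 * R := by
      rw [one_div_mul_eq_div, le_div_iff₀ (by positivity)]
      linarith
    linarith
  have hint : (∫ t in (0:ℝ)..T, (sqH1 Ω (tderiv ψ t) + sqL2 Ω (lap (tderiv ψ t)))) ≤
      T * R + 1 / b * R := by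
    have hq : ∀ t, sqH1 Ω (tderiv ψ t) + sqL2 Ω (lap (tderiv ψ t)) =
        (ig (fun p => v p ^ 2) t + - ig (fun p => v p * LL v p) t)
          + ig (fun p => LL v p ^ 2) t := by
      intro t
      rw [e4, sqH1, e1, sqL2_slice hKΩ Hv, sqL2_slice hKΩ HLv, sqGrad_slice hK hKΩ Hv]
    simp_rw [hq]
    have c1 : Continuous fun t => ig (fun p => v p ^ 2) t + - ig (fun p => v p * LL v p) t :=
      (ig_cont hK Hv.sq).add (ig_cont hK (Hv.mul HLv)).neg
    have c2 : Continuous fun t => ig (fun p => LL v p ^ 2) t := ig_cont hK HLv.sq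
    rw [intervalIntegral.integral_add (c1.intervalIntegrable _ _) (c2.intervalIntegrable _ _)]
    have i1 : ∫ t in (0:ℝ)..T, (ig (fun p => v p ^ 2) t + - ig (fun p => v p * LL v p) t)
        ≤ ∫ _t in (0:ℝ)..T, R := by
      refine intervalIntegral.integral_mono_on hT.le (c1.intervalIntegrable _ _)
        (continuous_const.intervalIntegrable _ _) fun t ht => ?_
      have hEt := g1 t ht
      rw [hEeq] at hEt
      have := mul_nonneg (sq_nonneg c) (nLu t)
      have := nu t
      linarith
    have i2 : ∫ t in (0:ℝ)..T, ig (fun p => LL v p ^ 2) t ≤ 1 / b * R := by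
      rw [one_div_mul_eq_div, le_div_iff₀ hb]
      linarith
    simp at i1
    linarith
  have hcoef : 0 ≤ 3 / 2 * (1 + 1 / c ^ 2) + T + 1 / b := by positivity
  have := mul_le_mul_of_nonneg_left hRle hcoef
  linarith
end
end

section
/- Let d ∈ {1,2,3}. There exists a constant C > 0, depending only on d, such that every C^∞ function u : ℝ^d → ℝ with compact support satisfies ‖u‖_{L^∞(ℝ^d)} ≤ C (‖u‖_{L²(ℝ^d)}² + ‖∇u‖_{L²(ℝ^d)}² + ‖D²u‖_{L²(ℝ^d)}²)^{d/8} · ‖u‖_{L²(ℝ^d)}^{1 − d/4}. -/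
open MeasureTheory Real

noncomputable section

variable {d : ℕ}

open scoped SchwartzMap FourierTransform Laplacian

theorem agmon_fourier_lap {d : ℕ} (f : 𝓢(Spc d, ℂ)) (ξ : Spc d) :
    ‖𝓕 (Δ f) ξ‖ = (2 * π) ^ 2 * (‖ξ‖ ^ 2 * ‖𝓕 f ξ‖) := by
  rw [SchwartzMap.laplacian_eq_fourierMultiplierCLM, SchwartzMap.fourierMultiplierCLM_apply,
    FourierTransform.fourier_smul, FourierTransform.fourier_fourierInv_eq,
    _root_.smul_apply, SchwartzMap.smulLeftCLM_apply_apply (by fun_prop)]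
  rw [norm_smul, norm_smul]
  simp [abs_of_pos Real.pi_pos]

theorem agmon_sup_le {d : ℕ} (f : 𝓢(Spc d, ℂ)) (x : Spc d) :
    ‖f x‖ ≤ ∫ ξ, ‖𝓕 f ξ‖ := by
  have h : f x = 𝓕⁻ (𝓕 f) x := by rw [FourierTransform.fourierInv_fourier_eq]
  rw [h, SchwartzMap.fourierInv_coe, Real.fourierInv_eq]
  refine (norm_integral_le_integral_norm _).trans_eq ?_
  simp

theorem agmon_sq_int {d : ℕ} (f : 𝓢(Spc d, ℂ)) : Integrable (fun x => ‖f x‖ ^ 2) :=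
  (f.memLp 2).norm.integrable_sq

theorem agmon_core {d : ℕ} (hd : d < 4) (f : 𝓢(Spc d, ℂ)) (x : Spc d) {t R : ℝ}
    (ht : 0 < t) (hR : 0 < R) :
    ‖f x‖ ≤ t * (R ^ d * ∫ x : Spc d, (1 + ‖x‖) ^ (-(4:ℝ)))
      + t⁻¹ * (8 * ((∫ x, ‖f x‖ ^ 2) + (R ^ 4)⁻¹ * ∫ x, ‖Δ f x‖ ^ 2)) := by
  refine (agmon_sup_le f x).trans ?_
  have hw : Integrable (fun x : Spc d => (1 + ‖x‖) ^ (-(4:ℝ))) :=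
    integrable_one_add_norm (by simpa using (by exact_mod_cast hd : (d:ℝ) < 4))
  have hw' : Integrable (fun x : Spc d => (1 + ‖R⁻¹ • x‖) ^ (-(4:ℝ))) :=
    hw.comp_smul (inv_ne_zero hR.ne')
  have e1 : R ^ d * ∫ x : Spc d, (1 + ‖x‖) ^ (-(4:ℝ))
      = ∫ x : Spc d, (1 + ‖R⁻¹ • x‖) ^ (-(4:ℝ)) := by
    rw [Measure.integral_comp_inv_smul_of_nonneg volume
      (fun x : Spc d => (1 + ‖x‖) ^ (-(4:ℝ))) hR.le]
    simp
  have i1 := agmon_sq_int (𝓕 f)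
  have i2 := agmon_sq_int (𝓕 (Δ f))
  have i3 : Integrable (fun a => t⁻¹ * (8 * (‖𝓕 f a‖ ^ 2 + (R ^ 4)⁻¹ * ‖𝓕 (Δ f) a‖ ^ 2))) :=
    ((i1.add (i2.const_mul _)).const_mul _).const_mul _
  rw [e1, ← SchwartzMap.integral_norm_sq_fourier f, ← SchwartzMap.integral_norm_sq_fourier (Δ f),
    ← integral_const_mul, ← integral_const_mul (R ^ 4)⁻¹, ← integral_add i1 (i2.const_mul _),
    ← integral_const_mul, ← integral_const_mul,
    ← integral_add (hw'.const_mul _) i3]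
  refine integral_mono (𝓕 f).integrable.norm
    ((hw'.const_mul _).add i3) ?_
  intro ξ
  simp only [agmon_fourier_lap, Pi.add_apply]
  set a := ‖𝓕 f ξ‖ with ha
  have ha0 : 0 ≤ a := norm_nonneg _
  set s := ‖R⁻¹ • ξ‖ with hs
  have hs0 : 0 ≤ s := norm_nonneg _
  have hξ : ‖ξ‖ = R * s := by
    rw [hs, norm_smul, Real.norm_of_nonneg (by positivity)]; field_simp
  rw [hξ]
  have e2 : (1 + s) ^ (-(4:ℝ)) = ((1 + s) ^ 4)⁻¹ := by
    rw [Real.rpow_neg (by positivity)]; norm_cast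
  rw [e2]
  have hp : (1:ℝ) ≤ (2 * π) ^ 4 := one_le_pow₀ (by linarith [Real.pi_gt_three])
  have e3 : (R ^ 4)⁻¹ * ((2 * π) ^ 2 * ((R * s) ^ 2 * a)) ^ 2 = (2 * π) ^ 4 * (s ^ 4 * a ^ 2) := by
    field_simp
  rw [e3]
  have e4 : s ^ 4 * a ^ 2 ≤ (2 * π) ^ 4 * (s ^ 4 * a ^ 2) :=
    le_mul_of_one_le_left (by positivity) hp
  have e5 : (1 + s) ^ 4 ≤ 8 * (1 + s ^ 4) := by
    have h1 : (1 + s) ^ 2 ≤ 2 * (1 + s ^ 2) := by nlinarith [sq_nonneg (1 - s)]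
    have h2 : ((1 + s) ^ 2) ^ 2 ≤ (2 * (1 + s ^ 2)) ^ 2 := pow_le_pow_left₀ (by positivity) h1 2
    nlinarith [sq_nonneg (1 - s ^ 2)]
  have e6 : (1 + s) ^ 4 * a ^ 2 ≤ 8 * (a ^ 2 + (2 * π) ^ 4 * (s ^ 4 * a ^ 2)) := by
    have := mul_le_mul_of_nonneg_right e5 (sq_nonneg a)
    nlinarith
  have e7 : t⁻¹ * ((1 + s) ^ 4 * a ^ 2) ≤ t⁻¹ * (8 * (a ^ 2 + (2 * π) ^ 4 * (s ^ 4 * a ^ 2))) :=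
    mul_le_mul_of_nonneg_left e6 (by positivity)
  refine le_trans ?_ (add_le_add_right e7 _)
  have hW : 0 < (1 + s) ^ 4 := by positivity
  set W := (1 + s) ^ 4
  have : t * W⁻¹ + t⁻¹ * (W * a ^ 2) = (t ^ 2 + (W * a) ^ 2) / (t * W) := by
    field_simp
  rw [this, le_div_iff₀ (by positivity)]
  nlinarith [sq_nonneg (t - W * a), sq_nonneg (t + W * a)]

theorem agmon_lap_le {d : ℕ} (f : 𝓢(Spc d, ℂ)) (x : Spc d) :
    ‖Δ f x‖ ≤ d * ‖iteratedFDeriv ℝ 2 f x‖ := by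
  rw [SchwartzMap.laplacian_apply,
    InnerProductSpace.laplacian_eq_iteratedFDeriv_orthonormalBasis f
      (EuclideanSpace.basisFun (Fin d) ℝ)]
  refine (norm_sum_le _ _).trans ?_
  have : ∀ i ∈ Finset.univ, ‖iteratedFDeriv ℝ 2 f x ![EuclideanSpace.basisFun (Fin d) ℝ i,
      EuclideanSpace.basisFun (Fin d) ℝ i]‖ ≤ ‖iteratedFDeriv ℝ 2 f x‖ := by
    intro i _
    refine ((iteratedFDeriv ℝ 2 f x).le_opNorm _).trans ?_
    simp [Fin.prod_univ_two]
  refine (Finset.sum_le_sum this).trans ?_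
  simp

theorem agmon_pointwise {d : ℕ} (hd : d < 4) (u : Spc d → ℝ) (hu : ContDiff ℝ (⊤ : ℕ∞) u)
    (hc : HasCompactSupport u) (x : Spc d) {t R : ℝ} (ht : 0 < t) (hR : 0 < R) :
    |u x| ≤ t * (R ^ d * ∫ x : Spc d, (1 + ‖x‖) ^ (-(4:ℝ)))
      + t⁻¹ * (8 * ((∫ x, (u x) ^ 2) +
        (R ^ 4)⁻¹ * ((d:ℝ) ^ 2 * ∫ x, ‖iteratedFDeriv ℝ 2 u x‖ ^ 2))) := by
  have hc' : HasCompactSupport (Complex.ofRealLI ∘ u) := hc.comp_left (by simp)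
  have hu' : ContDiff ℝ (⊤ : ℕ∞) (Complex.ofRealLI ∘ u) :=
    Complex.ofRealLI.contDiff.comp hu
  let f : 𝓢(Spc d, ℂ) := hc'.toSchwartzMap hu'
  have hf : ∀ y, ‖f y‖ = |u y| := fun y => by
    change ‖Complex.ofRealLI (u y)‖ = _
    simp
  have hf2 : ∀ y, ‖iteratedFDeriv ℝ 2 f y‖ = ‖iteratedFDeriv ℝ 2 u y‖ := fun y =>
    Complex.ofRealLI.norm_iteratedFDeriv_comp_left (hu.contDiffAt (x := y)) (WithTop.coe_le_coe.2 (le_top : (2:ℕ∞) ≤ ⊤))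
  have h := agmon_core hd f x ht hR
  simp only [hf, sq_abs] at h
  refine h.trans ?_
  gcongr
  rw [← integral_const_mul]
  refine integral_mono (agmon_sq_int (Δ f)) ?_ ?_
  · refine Integrable.const_mul ?_ _
    have hcont : Continuous (fun y => ‖iteratedFDeriv ℝ 2 u y‖ ^ 2) :=
      ((hu.continuous_iteratedFDeriv (m := 2) (WithTop.coe_le_coe.2 (le_top : (2:ℕ∞) ≤ ⊤))).norm.pow 2)
    refine hcont.integrable_of_hasCompactSupport ?_
    exact (hc.iteratedFDeriv 2).comp_left (g := fun v => ‖v‖ ^ 2) (by simp)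
  · intro y
    have := agmon_lap_le f y
    rw [hf2] at this
    dsimp only
    rw [← mul_pow]
    exact pow_le_pow_left₀ (norm_nonneg _) this 2

/-- Agmon's inequality in dimension d ≤ 3:
‖u‖_{L^∞} ≤ C ‖u‖_{H²}^{d/4} ‖u‖_{L²}^{1−d/4}. -/
theorem agmon_inequality (d : ℕ) (hd : d = 1 ∨ d = 2 ∨ d = 3) :
    ∃ C > (0:ℝ), ∀ u : Spc d → ℝ, ContDiff ℝ (⊤ : ℕ∞) u → HasCompactSupport u →
      essSup (fun x => (|u x| : ℝ)) (volume : Measure (Spc d))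
        ≤ C * ((∫ x : Spc d, (u x) ^ 2) + (∫ x : Spc d, ‖gradient u x‖ ^ 2)
                + ∫ x : Spc d, ‖iteratedFDeriv ℝ 2 u x‖ ^ 2) ^ ((d:ℝ)/8)
            * (Real.sqrt (∫ x : Spc d, (u x) ^ 2)) ^ (1 - (d:ℝ)/4) := by
  have hd4 : d < 4 := by omega
  have : Nonempty (Fin d) := ⟨⟨0, by omega⟩⟩
  set K : ℝ := ∫ x : Spc d, (1 + ‖x‖) ^ (-(4:ℝ)) with hK
  have hK0 : 0 ≤ K := integral_nonneg fun x => by positivity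
  refine ⟨K + 8 * (1 + (d:ℝ) ^ 2), by positivity, ?_⟩
  intro u hu hc
  set A : ℝ := ∫ x : Spc d, (u x) ^ 2 with hA
  set G : ℝ := ∫ x : Spc d, ‖gradient u x‖ ^ 2 with hG
  set H : ℝ := ∫ x : Spc d, ‖iteratedFDeriv ℝ 2 u x‖ ^ 2 with hH
  have hA0 : 0 ≤ A := integral_nonneg fun x => by positivity
  have hG0 : 0 ≤ G := integral_nonneg fun x => by positivity
  have hH0 : 0 ≤ H := integral_nonneg fun x => by positivity
  refine essSup_le_of_ae_le _ (Filter.Eventually.of_forall fun x => ?_) ?_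
  swap
  · exact Filter.isCoboundedUnder_le_of_le _ (x := 0) fun x => abs_nonneg _
  dsimp only
  rcases hA0.eq_or_lt with hA1 | hA1
  · have hcont : Continuous (fun y => (u y) ^ 2) := hu.continuous.pow 2
    have hint : Integrable (fun y => (u y) ^ 2) :=
      hcont.integrable_of_hasCompactSupport (hc.comp_left (g := fun v => v ^ 2) (by simp))
    have h0 := (integral_eq_zero_iff_of_nonneg (fun y => sq_nonneg (u y)) hint).1 hA1.symm
    have h1 : (fun y => (u y) ^ 2) = 0 :=
      (Continuous.ae_eq_iff_eq volume hcont continuous_zero).1 h0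
    have h2 : u x = 0 := by simpa using congrFun h1 x
    rw [h2, abs_zero]
    positivity
  · set N := A + G + H with hN
    have hN0 : 0 < N := by positivity
    set R : ℝ := (N / A) ^ ((1:ℝ) / 4) with hR
    have hR0 : 0 < R := by positivity
    have hR4 : R ^ 4 = N / A := by
      rw [hR, ← Real.rpow_natCast, ← Real.rpow_mul (by positivity)]; norm_num
    set Q : ℝ := (N / A) ^ ((d:ℝ) / 8) with hQ
    have hQ0 : 0 < Q := by positivity
    have hRd : R ^ d = Q ^ 2 := by
      rw [hR, hQ, ← Real.rpow_natCast, ← Real.rpow_natCast, ← Real.rpow_mul (by positivity),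
        ← Real.rpow_mul (by positivity)]
      congr 1; push_cast; ring
    set S := Real.sqrt A with hS
    have hS0 : 0 < S := Real.sqrt_pos.2 hA1
    have hSA : A = S ^ 2 := (Real.sq_sqrt hA0).symm
    have h := agmon_pointwise hd4 u hu hc x (t := S / Q) (R := R) (by positivity) hR0
    rw [← hK, ← hA, ← hH, hRd, hR4] at h
    have hB : A + (N / A)⁻¹ * ((d:ℝ) ^ 2 * H) ≤ (1 + (d:ℝ) ^ 2) * A := by
      have : (N / A)⁻¹ * ((d:ℝ) ^ 2 * H) = (d:ℝ) ^ 2 * A * (H / N) := by field_simp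
      have h1 : H / N ≤ 1 := (div_le_one hN0).2 (by linarith)
      rw [this]
      have := mul_le_mul_of_nonneg_left h1 (by positivity : 0 ≤ (d:ℝ) ^ 2 * A)
      linarith
    have hfin : N ^ ((d:ℝ) / 8) * S ^ (1 - (d:ℝ) / 4) = Q * S := by
      have e : A ^ ((d:ℝ) / 8) = S ^ ((d:ℝ) / 4) := by
        rw [hSA, ← Real.rpow_natCast, ← Real.rpow_mul hS0.le]
        congr 1; push_cast; ring
      rw [hQ, Real.div_rpow hN0.le hA0, e, Real.rpow_sub hS0, Real.rpow_one]
      field_simp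
    rw [mul_assoc, hfin]
    refine h.trans ?_
    have : (S / Q)⁻¹ * (8 * (A + (N / A)⁻¹ * ((d:ℝ) ^ 2 * H)))
        ≤ (S / Q)⁻¹ * (8 * ((1 + (d:ℝ) ^ 2) * A)) := by gcongr
    refine (add_le_add_right this _).trans_eq ?_
    have e8 : (S / Q)⁻¹ * (8 * ((1 + (d:ℝ) ^ 2) * A)) = 8 * (1 + (d:ℝ) ^ 2) * (Q * S) := by
      rw [hSA]; field_simp
    rw [e8]
    field_simp
end
end
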